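/- arXiv:2503.11259 — 2 statements merged into one kernel-verified Lean document; each statement's English description precedes it below -/
import Mathlib

section
/- For each p ∈ (1,∞) there exists a constant C_p > 0, independent of the dimension d ∈ ℤ_+, such that for every d ∈ ℤ_+ and every f ∈ ℓ^p(ℤ^d) one has ‖ sup_{t>0} |G_t f| ‖_{ℓ^p(ℤ^d)} ≤ C_p ‖f‖_{ℓ^p(ℤ^d)}. -/
open scoped ENNReal Real BigOperators
open Real

/-- The one-dimensional Theta function `θ_t(ζ) = Σ_{k∈ℤ} exp(-π(k-ζ)²t)`. -/
noncomputable def theta (t ζ : ℝ) : ℝ :=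
  ∑' k : ℤ, Real.exp (-π * ((k : ℝ) - ζ) ^ 2 * t)

/-- The d-dimensional Theta function `Θ_t(ξ) = Π_j θ_t(ξ_j)`. -/
noncomputable def bigTheta (d : ℕ) (t : ℝ) (ξ : Fin d → ℝ) : ℝ :=
  ∏ j, theta t (ξ j)

/-- The discrete normalized Gaussian kernel `g_t(n) = Θ_{1/t}(0)⁻¹ exp(-π|n|²/t)`. -/
noncomputable def gauss (d : ℕ) (t : ℝ) (n : Fin d → ℤ) : ℝ :=
  (bigTheta d (1 / t) 0)⁻¹ * Real.exp (-π * (∑ j, ((n j : ℝ)) ^ 2) / t)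

/-- The convolution operator `G_t f(x) = Σ_n g_t(n) f(x-n)` on ℤ^d. -/
noncomputable def gConv (d : ℕ) (t : ℝ) (f : (Fin d → ℤ) → ℂ) (x : Fin d → ℤ) : ℂ :=
  ∑' n : Fin d → ℤ, (gauss d t n : ℂ) * f (x - n)

/-- The ℓ^p norm (valued in ℝ≥0∞) of an ℝ≥0∞-valued function on ℤ^d. -/
noncomputable def lpNorm (d : ℕ) (p : ℝ) (F : (Fin d → ℤ) → ℝ≥0∞) : ℝ≥0∞ :=
  (∑' x : Fin d → ℤ, F x ^ p) ^ (1 / p)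

namespace MG
open scoped NNReal

section chain
variable {E : Type} [AddCommGroup E]

/-- translation action -/
noncomputable def shiftHom (E : Type) [AddCommGroup E] :
    Multiplicative E →* Module.End ℝ≥0 (E → ℝ≥0∞) where
  toFun n :=
    { toFun := fun f x => f (x - n.toAdd)
      map_add' := fun f g => rfl
      map_smul' := fun c f => rfl }
  map_one' := by ext f x; simp
  map_mul' a b := by ext f x; simp [sub_sub]

noncomputable def act (E : Type) [AddCommGroup E] :
    AddMonoidAlgebra ℝ≥0 E →ₐ[ℝ≥0] Module.End ℝ≥0 (E → ℝ≥0∞) :=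
  AddMonoidAlgebra.lift ℝ≥0 _ E (shiftHom E)

lemma act_apply (P : AddMonoidAlgebra ℝ≥0 E) (f : E → ℝ≥0∞) (x : E) :
    act E P f x = ∑ n ∈ P.coeff.support, (P.coeff n : ℝ≥0∞) * f (x - n) := by
  simp [act, AddMonoidAlgebra.lift_apply, Finsupp.sum, shiftHom, ENNReal.smul_def]

lemma act_ge (P : AddMonoidAlgebra ℝ≥0 E) (f : E → ℝ≥0∞) (x : E) (N : Finset E) :
    ∑ n ∈ N, (P.coeff n : ℝ≥0∞) * f (x - n) ≤ act E P f x := by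
  classical
  rw [act_apply]
  calc _ ≤ ∑ n ∈ N ∪ P.coeff.support, (P.coeff n : ℝ≥0∞) * f (x - n) :=
        Finset.sum_le_sum_of_subset Finset.subset_union_left
    _ = _ := by
        symm
        apply Finset.sum_subset Finset.subset_union_right
        intro n _ hn
        simp at hn
        simp [hn]

/-- total mass -/
noncomputable def mass (E : Type) [AddCommGroup E] : AddMonoidAlgebra ℝ≥0 E →ₐ[ℝ≥0] ℝ≥0 :=
  AddMonoidAlgebra.lift ℝ≥0 _ E 1

lemma mass_apply (P : AddMonoidAlgebra ℝ≥0 E) :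
    mass E P = ∑ n ∈ P.coeff.support, P.coeff n := by
  simp [mass, AddMonoidAlgebra.lift_apply, Finsupp.sum]

noncomputable def rfx (E : Type) [AddCommGroup E] :
    AddMonoidAlgebra ℝ≥0 E →ₐ[ℝ≥0] AddMonoidAlgebra ℝ≥0 E :=
  AddMonoidAlgebra.mapDomainAlgHom ℝ≥0 ℝ≥0 (negAddMonoidHom : E →+ E)

lemma act_rfx_apply (P : AddMonoidAlgebra ℝ≥0 E) (f : E → ℝ≥0∞) (x : E) :
    act E (rfx E P) f x = ∑ n ∈ P.coeff.support, (P.coeff n : ℝ≥0∞) * f (x + n) := by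
  rw [act, AddMonoidAlgebra.lift_apply]
  simp only [rfx, AddMonoidAlgebra.mapDomainAlgHom_apply, AddMonoidAlgebra.mapDomain]
  rw [Finsupp.sum_mapDomain_index (by simp) (by intros; simp [add_smul])]
  simp [Finsupp.sum, shiftHom, ENNReal.smul_def]

lemma tsum_shift (f : E → ℝ≥0∞) (a : E) : ∑' x, f (x + a) = ∑' x, f x :=
  (Equiv.addRight a).tsum_eq f

lemma tsum_shift' (f : E → ℝ≥0∞) (a : E) : ∑' x, f (x - a) = ∑' x, f x :=
  (Equiv.subRight a).tsum_eq f

lemma tsum_act (P : AddMonoidAlgebra ℝ≥0 E) (hP : mass E P = 1) (f : E → ℝ≥0∞) :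
    ∑' x, act E P f x = ∑' x, f x := by
  simp_rw [act_apply]
  rw [Summable.tsum_finsetSum (fun _ _ => ENNReal.summable)]
  simp_rw [ENNReal.tsum_mul_left, tsum_shift']
  rw [← Finset.sum_mul]
  rw [mass_apply] at hP
  have : (∑ n ∈ P.coeff.support, (P.coeff n : ℝ≥0∞)) = 1 := by exact_mod_cast hP
  rw [this, one_mul]

/-- `c = p/(p-1)` -/
lemma pointwise1 {p : ℝ} (hp : 1 < p) (f m : ℝ≥0∞) :
    (max f m) ^ p + ENNReal.ofReal (p / (p - 1)) * (m ^ (p - 1) * f)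
      ≤ m ^ p + ENNReal.ofReal (p / (p - 1)) * ((max f m) ^ (p - 1) * f) := by
  rcases le_total f m with h | h
  · rw [max_eq_right h]
  rw [max_eq_left h]
  have hpq : p.HolderConjugate (p / (p - 1)) := Real.HolderConjugate.conjExponent hp
  have h0 : 0 < p - 1 := by linarith
  have y := ENNReal.young_inequality f (m ^ (p - 1)) hpq
  have e1 : (m ^ (p - 1)) ^ (p / (p - 1)) = m ^ p := by
    rw [← ENNReal.rpow_mul]; congr 1; field_simp
  have e2 : f ^ (p - 1) * f = f ^ p := by
    nth_rewrite 2 [← ENNReal.rpow_one f]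
    rw [← ENNReal.rpow_add_of_nonneg _ _ h0.le zero_le_one]; congr 1; ring
  rw [e1] at y
  rw [e2]
  set c := ENNReal.ofReal (p / (p - 1)) with hc
  have hc0 : c ≠ 0 := by
    rw [hc]; simp; positivity
  have hct : c ≠ ⊤ := ENNReal.ofReal_ne_top
  have hc1 : c / ENNReal.ofReal p + 1 = c := by
    rw [hc, ← ENNReal.ofReal_div_of_pos (by linarith), ← ENNReal.ofReal_one, ← ENNReal.ofReal_add (by positivity) (by positivity)]
    congr 1; field_simp; ring
  calc f ^ p + c * (m ^ (p - 1) * f) ≤ f ^ p + c * (f ^ p / ENNReal.ofReal p + m ^ p / c) := by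
        gcongr; rw [mul_comm]; exact y
    _ = m ^ p + (c / ENNReal.ofReal p + 1) * f ^ p := by
        rw [mul_add, ENNReal.mul_div_cancel hc0 hct]
        simp only [div_eq_mul_inv]
        ring
    _ = _ := by rw [hc1]

lemma pointwise2 {p : ℝ} (hp : 1 < p) (c : ℝ≥0∞) (f m : ℝ≥0∞) :
    c * (m ^ (p - 1) * f) ≤ 2⁻¹ * m ^ p + c * (2 * c) ^ (p - 1) * f ^ p := by
  have h0 : 0 < p - 1 := by linarith
  have e2 (f : ℝ≥0∞) : f ^ (p - 1) * f = f ^ p := by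
    nth_rewrite 2 [← ENNReal.rpow_one f]
    rw [← ENNReal.rpow_add_of_nonneg _ _ h0.le zero_le_one]; congr 1; ring
  rcases le_total m (2 * c * f) with h | h
  · refine le_add_left ?_
    calc c * (m ^ (p - 1) * f) ≤ c * ((2 * c * f) ^ (p - 1) * f) := by gcongr
      _ = _ := by rw [ENNReal.mul_rpow_of_nonneg _ _ h0.le, ← e2 f]; ring
  · refine le_add_right ?_
    calc c * (m ^ (p - 1) * f) = 2⁻¹ * (m ^ (p - 1) * (2 * c * f)) := by
          have : (2⁻¹ : ℝ≥0∞) * 2 = 1 := ENNReal.inv_mul_cancel (by simp) (by simp)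
          calc _ = (2⁻¹ * 2) * (c * (m ^ (p - 1) * f)) := by rw [this, one_mul]
            _ = _ := by ring
      _ ≤ 2⁻¹ * (m ^ (p - 1) * m) := by gcongr
      _ = _ := by rw [e2]

lemma chain {p : ℝ} (hp : 1 < p) (K : ℕ) : ∀ (P : ℕ → AddMonoidAlgebra ℝ≥0 E),
    (∀ l, mass E (P l) = 1) → ∀ f : E → ℝ≥0∞, ∑' x, f x ≠ ⊤ →
    ∃ (Ω : Type) (_ : Fintype Ω) (w : Ω → ℝ≥0∞) (m : Ω → E → ℝ≥0∞),
      ∑ ω, w ω = 1 ∧ (∀ ω x, m ω x ≤ ∑' x, f x) ∧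
      (∀ k ≤ K, ∀ x, act E (∏ l ∈ Finset.range k, (P l * rfx E (P l))) f x
        ≤ ∑ ω, w ω * m ω x) ∧
      (∑' x, ∑ ω, w ω * (m ω x) ^ p ≤
        ∑' x, ∑ ω, w ω * (ENNReal.ofReal (p / (p - 1)) * ((m ω x) ^ (p - 1) * f x))) := by
  have h0 : 0 < p - 1 := by linarith
  have e2 (f : ℝ≥0∞) : f ^ (p - 1) * f = f ^ p := by
    nth_rewrite 2 [← ENNReal.rpow_one f]
    rw [← ENNReal.rpow_add_of_nonneg _ _ h0.le zero_le_one]; congr 1; ring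
  have hc1 : 1 ≤ ENNReal.ofReal (p / (p - 1)) := by
    rw [ENNReal.one_le_ofReal, le_div_iff₀ h0]; linarith
  induction K with
  | zero =>
    intro P hP f hf
    refine ⟨Unit, inferInstance, fun _ => 1, fun _ => f, by simp, ?_, ?_, ?_⟩
    · intro _ x; exact ENNReal.le_tsum x
    · intro k hk x
      obtain rfl : k = 0 := by omega
      simp
    · simp only [Finset.univ_unique, Finset.sum_singleton, one_mul, e2]
      exact ENNReal.tsum_le_tsum fun x => le_mul_of_one_le_left zero_le hc1
  | succ K ih =>
    intro P hP f hf
    obtain ⟨Ω, _, w, m, hw, hm, hT, hmain⟩ := ih (fun l => P (l + 1)) (fun l => hP _)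
      (act E (P 0) f) (by rwa [tsum_act _ (hP 0)])
    rw [tsum_act _ (hP 0)] at hm
    set S := (P 0).coeff.support with hS
    have hS1 : ∑ b : S, ((P 0).coeff b : ℝ≥0∞) = 1 := by
      have := hP 0
      rw [mass_apply, ← hS, ← Finset.sum_coe_sort] at this
      exact_mod_cast this
    have hw' : ∑ o : S × Ω, (((P 0).coeff o.1 : ℝ≥0∞) * w o.2) = 1 := by
      rw [Fintype.sum_prod_type]
      simp only [← Finset.mul_sum, hw, mul_one, hS1]
    refine ⟨S × Ω, inferInstance, fun o => (P 0).coeff o.1 * w o.2,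
      fun o x => max (f x) (m o.2 (x + o.1)), hw', ?_, ?_, ?_⟩
    · intro o x
      exact max_le (ENNReal.le_tsum x) (hm _ _)
    · intro k hk x
      cases k with
      | zero =>
        simp only [Finset.range_zero, Finset.prod_empty, map_one, Module.End.one_apply]
        calc f x = ∑ o : S × Ω, (((P 0).coeff o.1 : ℝ≥0∞) * w o.2) * f x := by
              rw [← Finset.sum_mul, hw', one_mul]
          _ ≤ _ := by gcongr; exact le_max_left _ _
      | succ k =>
        have : (∏ l ∈ Finset.range (k + 1), (P l * rfx E (P l)))
            = rfx E (P 0) * ((∏ l ∈ Finset.range k, (P (l + 1) * rfx E (P (l + 1)))) * P 0) := by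
          rw [Finset.prod_range_succ']; ring
        rw [this, map_mul, map_mul]
        simp only [Module.End.mul_apply]
        rw [act_rfx_apply, ← hS, ← Finset.sum_coe_sort, Fintype.sum_prod_type]
        refine Finset.sum_le_sum fun b _ => ?_
        calc _ ≤ ((P 0).coeff b : ℝ≥0∞) * ∑ ω, w ω * m ω (x + b) := by
              gcongr
              exact hT k (by omega) _
          _ = ∑ ω, ((P 0).coeff b : ℝ≥0∞) * w ω * m ω (x + b) := by
              simp [Finset.mul_sum, mul_assoc]
          _ ≤ _ := by gcongr; exact le_max_right _ _
    · set c := ENNReal.ofReal (p / (p - 1)) with hc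
      have key : ∀ (F : Ω → E → ℝ≥0∞),
          ∑' x, ∑ o : S × Ω, (((P 0).coeff o.1 : ℝ≥0∞) * w o.2) * F o.2 (x + o.1)
            = ∑' x, ∑ ω, w ω * F ω x := by
        intro F
        rw [Summable.tsum_finsetSum (fun _ _ => ENNReal.summable),
          Summable.tsum_finsetSum (fun _ _ => ENNReal.summable), Fintype.sum_prod_type]
        simp_rw [ENNReal.tsum_mul_left]
        simp_rw [tsum_shift (F _)]
        simp_rw [mul_assoc, ← Finset.mul_sum]
        rw [← Finset.sum_mul, hS1, one_mul]
      set X := ∑' x, ∑ o : S × Ω, (((P 0).coeff o.1 : ℝ≥0∞) * w o.2) *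
        (c * (m o.2 (x + o.1) ^ (p - 1) * f x)) with hX
      have hXeq : ∑' x, ∑ ω, w ω * (c * ((m ω x) ^ (p - 1) * act E (P 0) f x)) = X := by
        rw [hX, Summable.tsum_finsetSum (fun _ _ => ENNReal.summable),
          Summable.tsum_finsetSum (fun _ _ => ENNReal.summable), Fintype.sum_prod_type,
          Finset.sum_comm]
        refine Finset.sum_congr rfl fun ω _ => ?_
        simp_rw [act_apply, ← hS, Finset.mul_sum]
        rw [Summable.tsum_finsetSum (fun _ _ => ENNReal.summable), ← Finset.sum_coe_sort]
        refine Finset.sum_congr rfl fun b _ => ?_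
        rw [← tsum_shift _ (b : E)]
        refine tsum_congr fun x => ?_
        rw [add_sub_cancel_right]
        ring
      have hXfin : X ≠ ⊤ := by
        have : X ≤ ∑' x, (c * (∑' x, f x) ^ (p - 1)) * f x := by
          refine ENNReal.tsum_le_tsum fun x => ?_
          calc _ ≤ ∑ o : S × Ω, (((P 0).coeff o.1 : ℝ≥0∞) * w o.2) *
                  (c * ((∑' x, f x) ^ (p - 1) * f x)) := by
                gcongr; exact hm _ _
            _ = _ := by rw [← Finset.sum_mul, hw', one_mul, mul_assoc]
        refine ne_top_of_le_ne_top ?_ this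
        rw [ENNReal.tsum_mul_left]
        refine ENNReal.mul_ne_top (ENNReal.mul_ne_top ENNReal.ofReal_ne_top ?_) hf
        exact ENNReal.rpow_ne_top_of_nonneg h0.le hf
      rw [hXeq] at hmain
      refine (ENNReal.add_le_add_iff_right hXfin).1 ?_
      calc _ = ∑' x, ∑ o : S × Ω, (((P 0).coeff o.1 : ℝ≥0∞) * w o.2) *
              ((max (f x) (m o.2 (x + o.1))) ^ p + c * (m o.2 (x + o.1) ^ (p - 1) * f x)) := by
            rw [hX, ← ENNReal.tsum_add]
            simp_rw [mul_add, Finset.sum_add_distrib]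
        _ ≤ ∑' x, ∑ o : S × Ω, (((P 0).coeff o.1 : ℝ≥0∞) * w o.2) *
              (m o.2 (x + o.1) ^ p + c * ((max (f x) (m o.2 (x + o.1))) ^ (p - 1) * f x)) := by
            refine ENNReal.tsum_le_tsum fun x => ?_
            refine Finset.sum_le_sum fun o _ => mul_le_mul_right ?_ _
            exact pointwise1 hp _ _
        _ = (∑' x, ∑ ω, w ω * m ω x ^ p) + ∑' x, ∑ o : S × Ω, (((P 0).coeff o.1 : ℝ≥0∞) * w o.2)
              * (c * ((max (f x) (m o.2 (x + o.1))) ^ (p - 1) * f x)) := by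
            rw [← key (fun ω x => m ω x ^ p), ← ENNReal.tsum_add]
            simp_rw [mul_add, Finset.sum_add_distrib]
        _ ≤ _ := by rw [add_comm]; gcongr

/-- constant -/
noncomputable def cst (p : ℝ) : ℝ≥0∞ :=
  2 * (ENNReal.ofReal (p / (p - 1)) * (2 * ENNReal.ofReal (p / (p - 1))) ^ (p - 1))

lemma cst_ne_top {p : ℝ} (hp : 1 < p) : cst p ≠ ⊤ := by
  unfold cst
  refine ENNReal.mul_ne_top (by simp) (ENNReal.mul_ne_top (by simp)
    (ENNReal.rpow_ne_top_of_nonneg (by linarith) (ENNReal.mul_ne_top (by simp) (by simp))))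

lemma rota {p : ℝ} (hp : 1 < p) (K : ℕ) (P : ℕ → AddMonoidAlgebra ℝ≥0 E)
    (hP : ∀ l, mass E (P l) = 1) (f : E → ℝ≥0∞) (hf : ∑' x, f x ≠ ⊤) :
    ∑' x, (⨆ k ∈ Finset.range (K + 1),
      act E (∏ l ∈ Finset.range k, (P l * rfx E (P l))) f x) ^ p ≤ cst p * ∑' x, f x ^ p := by
  have h0 : 0 < p - 1 := by linarith
  obtain ⟨Ω, _, w, m, hw, hm, hT, hmain⟩ := chain hp K P hP f hf
  set c := ENNReal.ofReal (p / (p - 1)) with hc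
  have hc0 : c ≠ 0 := by
    rw [hc]; simp; positivity
  have hct : c ≠ ⊤ := ENNReal.ofReal_ne_top
  set Y := ∑' x, ∑ ω, w ω * (m ω x) ^ p with hY
  have hYfin : Y ≠ ⊤ := by
    refine ne_top_of_le_ne_top ?_ hmain
    have : (∑' x, ∑ ω, w ω * (c * ((m ω x) ^ (p - 1) * f x)))
        ≤ ∑' x, (c * (∑' x, f x) ^ (p - 1)) * f x := by
      refine ENNReal.tsum_le_tsum fun x => ?_
      calc _ ≤ ∑ ω, w ω * (c * ((∑' x, f x) ^ (p - 1) * f x)) := by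
            gcongr; exact hm _ _
        _ = _ := by rw [← Finset.sum_mul, hw, one_mul, mul_assoc]
    refine ne_top_of_le_ne_top ?_ this
    rw [ENNReal.tsum_mul_left]
    refine ENNReal.mul_ne_top (ENNReal.mul_ne_top hct ?_) hf
    exact ENNReal.rpow_ne_top_of_nonneg h0.le hf
  have h1 : Y ≤ 2⁻¹ * Y + c * (2 * c) ^ (p - 1) * ∑' x, f x ^ p := by
    refine hmain.trans ?_
    rw [hY, ← ENNReal.tsum_mul_left, ← ENNReal.tsum_mul_left, ← ENNReal.tsum_add]
    refine ENNReal.tsum_le_tsum fun x => ?_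
    calc _ ≤ ∑ ω, w ω * (2⁻¹ * m ω x ^ p + c * (2 * c) ^ (p - 1) * f x ^ p) := by
          gcongr; exact pointwise2 hp c _ _
      _ = _ := by
          simp_rw [mul_add, Finset.sum_add_distrib]
          rw [← Finset.sum_mul, hw, one_mul, Finset.mul_sum]
          congr 1
          refine Finset.sum_congr rfl fun ω _ => by ring
  have h2 : Y ≤ cst p * ∑' x, f x ^ p := by
    have hh : 2⁻¹ * Y ≠ ⊤ := ENNReal.mul_ne_top (by simp) hYfin
    have h3 : 2⁻¹ * Y ≤ c * (2 * c) ^ (p - 1) * ∑' x, f x ^ p := by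
      refine (ENNReal.add_le_add_iff_left hh).1 ?_
      rwa [← add_mul, ENNReal.inv_two_add_inv_two, one_mul]
    have : Y = 2 * (2⁻¹ * Y) := by
      rw [← mul_assoc, ENNReal.mul_inv_cancel (by simp) (by simp), one_mul]
    rw [this, cst, mul_assoc]
    exact mul_le_mul_right h3 _
  refine le_trans (ENNReal.tsum_le_tsum fun x => ?_) h2
  calc _ ≤ (∑ ω, w ω * m ω x) ^ p := by
        gcongr
        refine iSup₂_le fun k hk => hT k (by simp at hk; omega) x
    _ ≤ _ := ENNReal.rpow_arith_mean_le_arith_mean_rpow _ _ _ hw hp.le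

lemma mix {p : ℝ} (hp : 1 < p) (K : ℕ) {I : Type} [Fintype I] [DecidableEq I]
    (h : I → AddMonoidAlgebra ℝ≥0 E) (hh : ∀ i, mass E (h i) = 1)
    (w : I → ℕ → ℝ≥0) (hw : ∀ i, ∑ s ∈ Finset.range (K + 1), w i s = 1)
    (f : E → ℝ≥0∞) (hf : ∑' x, f x ≠ ⊤) :
    ∑' x, (⨆ k ∈ Finset.range (K + 1),
      act E (∏ i, ∑ s ∈ Finset.range (K + 1), w i s • (if s < k then h i * rfx E (h i) else 1)) f x)
        ^ p ≤ cst p * ∑' x, f x ^ p := by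
  set Tau := Fintype.piFinset (fun _ : I => Finset.range (K + 1)) with hTau
  set W : (I → ℕ) → ℝ≥0∞ := fun τ => ((∏ i, w i (τ i) : ℝ≥0) : ℝ≥0∞) with hWdef
  have hW : ∑ τ ∈ Tau, W τ = 1 := by
    have := Finset.prod_univ_sum (fun _ : I => Finset.range (K + 1)) w
    simp only [hw, Finset.prod_const_one] at this
    rw [hWdef, ← ENNReal.ofNNReal_finsetSum, ← this]; rfl
  set P : (I → ℕ) → ℕ → AddMonoidAlgebra ℝ≥0 E := fun τ l => ∏ i with τ i = l, h i with hPdef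
  have hP : ∀ τ l, mass E (P τ l) = 1 := by
    intro τ l
    simp [hPdef, map_prod, hh]
  have hexp : ∀ k x, act E (∏ i, ∑ s ∈ Finset.range (K + 1),
      w i s • (if s < k then h i * rfx E (h i) else 1)) f x
      = ∑ τ ∈ Tau, W τ * act E (∏ l ∈ Finset.range k, (P τ l * rfx E (P τ l))) f x := by
    intro k x
    rw [Finset.prod_univ_sum, map_sum]
    simp only [LinearMap.sum_apply, Finset.sum_apply]
    refine Finset.sum_congr rfl fun τ _ => ?_
    have e : (∏ l ∈ Finset.range k, (P τ l * rfx E (P τ l)))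
        = ∏ i, (if τ i < k then h i * rfx E (h i) else 1) := by
      simp only [hPdef, map_prod, ← Finset.prod_mul_distrib]
      rw [← Finset.prod_filter]
      rw [← Finset.prod_fiberwise_of_maps_to (s := Finset.univ.filter fun i => τ i < k)
        (t := Finset.range k) (g := τ) (by simp)]
      refine Finset.prod_congr rfl fun l hl => ?_
      refine Finset.prod_congr ?_ fun _ _ => rfl
      ext i
      simp at hl ⊢
      intro hi; omega
    rw [e, Finset.prod_smul, map_smul]
    simp [hWdef, ENNReal.smul_def]
  calc _ ≤ ∑' x, (∑ τ ∈ Tau, W τ * (⨆ k ∈ Finset.range (K + 1),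
      act E (∏ l ∈ Finset.range k, (P τ l * rfx E (P τ l))) f x)) ^ p := by
        refine ENNReal.tsum_le_tsum fun x => ?_
        gcongr
        refine iSup₂_le fun k hk => ?_
        rw [hexp]
        gcongr with τ
        exact le_iSup₂ (f := fun k (_ : k ∈ Finset.range (K + 1)) =>
          act E (∏ l ∈ Finset.range k, (P τ l * rfx E (P τ l))) f x) k hk
    _ ≤ ∑' x, ∑ τ ∈ Tau, W τ * (⨆ k ∈ Finset.range (K + 1),
      act E (∏ l ∈ Finset.range k, (P τ l * rfx E (P τ l))) f x) ^ p :=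
        ENNReal.tsum_le_tsum fun x =>
          ENNReal.rpow_arith_mean_le_arith_mean_rpow _ _ _ hW hp.le
    _ = ∑ τ ∈ Tau, W τ * ∑' x, (⨆ k ∈ Finset.range (K + 1),
      act E (∏ l ∈ Finset.range k, (P τ l * rfx E (P τ l))) f x) ^ p := by
        rw [Summable.tsum_finsetSum (fun _ _ => ENNReal.summable)]
        simp_rw [ENNReal.tsum_mul_left]
    _ ≤ ∑ τ ∈ Tau, W τ * (cst p * ∑' x, f x ^ p) := by
        gcongr with τ
        exact rota hp K (P τ) (hP τ) f hf
    _ = _ := by rw [← Finset.sum_mul, hW, one_mul]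

end chain
section oned
open Filter Topology

noncomputable def fac (r : ℝ≥0) : AddMonoidAlgebra ℝ≥0 ℤ :=
  AddMonoidAlgebra.single 1 (r / (1 + r) ^ 2) + AddMonoidAlgebra.single 0 ((1 + r ^ 2) / (1 + r) ^ 2)
    + AddMonoidAlgebra.single (-1) (r / (1 + r) ^ 2)

noncomputable def pker (q : ℝ≥0) (M : ℕ) : AddMonoidAlgebra ℝ≥0 ℤ :=
  ∏ m ∈ Finset.range M, fac (q ^ (2 * m + 1))

noncomputable def kk (q : ℝ≥0) (M : ℕ) (n : ℤ) : ℝ := ((pker q M).coeff n : ℝ)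

lemma kk_nonneg (q : ℝ≥0) (M : ℕ) (n : ℤ) : 0 ≤ kk q M n := NNReal.coe_nonneg _

lemma kk_zero (q : ℝ≥0) (n : ℤ) : kk q 0 n = if n = 0 then 1 else 0 := by
  simp only [kk, pker, Finset.range_zero, Finset.prod_empty, AddMonoidAlgebra.one_def,
    AddMonoidAlgebra.coeff_single, Finsupp.single_apply]
  split_ifs <;> simp_all

lemma kk_succ (q : ℝ≥0) (M : ℕ) (n : ℤ) :
    kk q (M + 1) n * (1 + (q : ℝ) ^ (2 * M + 1)) ^ 2 =
      (q : ℝ) ^ (2 * M + 1) * kk q M (n - 1) + (1 + ((q : ℝ) ^ (2 * M + 1)) ^ 2) * kk q M n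
        + (q : ℝ) ^ (2 * M + 1) * kk q M (n + 1) := by
  have hne : (1 + (q : ℝ) ^ (2 * M + 1)) ≠ 0 := by positivity
  simp only [kk]
  rw [pker, Finset.prod_range_succ, ← pker, mul_comm (pker q M), fac]
  simp only [add_mul, AddMonoidAlgebra.coeff_add, Finsupp.add_apply,
    AddMonoidAlgebra.coeff_single_mul_apply]
  rw [show -(1 : ℤ) + n = n - 1 by ring, show -(0 : ℤ) + n = n by ring,
    show - -(1 : ℤ) + n = n + 1 by ring]
  push_cast
  field_simp

lemma kk_symm (q : ℝ≥0) (M : ℕ) : ∀ n : ℤ, kk q M (-n) = kk q M n := by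
  induction M with
  | zero => intro n; simp [kk_zero]
  | succ M ih =>
    intro n
    have hne : (1 + (q : ℝ) ^ (2 * M + 1)) ^ 2 ≠ 0 := by positivity
    apply mul_right_cancel₀ hne
    rw [kk_succ, kk_succ, show -n - 1 = -(n + 1) by ring, show -n + 1 = -(n - 1) by ring, ih, ih, ih]
    ring

lemma kk_rel (q : ℝ≥0) (hq : 0 < q) (M : ℕ) : ∀ n : ℤ,
    kk q M (n + 1) * (1 - (q : ℝ) ^ (2 * M + 2) * (q : ℝ) ^ (2 * n))
      = kk q M n * (q * ((q : ℝ) ^ (2 * n) - (q : ℝ) ^ (2 * M))) := by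
  have hq' : (q : ℝ) ≠ 0 := by exact_mod_cast hq.ne'
  induction M with
  | zero =>
    intro n
    rw [kk_zero, kk_zero]
    split_ifs with h1 h2 h2
    · omega
    · obtain rfl : n = -1 := by omega
      have : (q : ℝ) ^ 2 * (q : ℝ) ^ (-2 : ℤ) = 1 := by
        rw [zpow_neg]
        field_simp
      simp only [mul_neg, mul_one] at *
      simp [-zpow_neg, this]
    · subst h2; simp
    · simp
  | succ M ih =>
    intro n
    have hne : (1 + (q : ℝ) ^ (2 * M + 1)) ^ 2 ≠ 0 := by positivity
    apply mul_right_cancel₀ hne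
    have a1 := kk_succ q M n
    have a2 := kk_succ q M (n + 1)
    rw [show n + 1 - 1 = n by ring] at a2
    have b1 := ih (n - 1)
    have b2 := ih n
    have b3 := ih (n + 1)
    rw [show n - 1 + 1 = n by ring] at b1
    have y1 : (q : ℝ) ^ (2 * n) = (q : ℝ) ^ 2 * (q : ℝ) ^ (2 * (n - 1)) := by
      rw [← zpow_natCast, ← zpow_add₀ hq']; congr 1; push_cast; ring
    have y2 : (q : ℝ) ^ (2 * (n + 1)) = (q : ℝ) ^ 4 * (q : ℝ) ^ (2 * (n - 1)) := by
      rw [← zpow_natCast, ← zpow_add₀ hq']; congr 1; push_cast; ring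
    rw [y1] at b2 ⊢
    rw [y2] at b3
    have x1 : (q : ℝ) ^ (2 * M + 1) = q * q ^ (2 * M) := by ring
    have x2 : (q : ℝ) ^ (2 * M + 2) = q ^ 2 * q ^ (2 * M) := by ring
    have x3 : (q : ℝ) ^ (2 * (M + 1)) = q ^ 2 * q ^ (2 * M) := by ring
    have x4 : (q : ℝ) ^ (2 * (M + 1) + 2) = q ^ 4 * q ^ (2 * M) := by ring
    simp only [x1, x2, x3, x4] at *
    generalize (q : ℝ) ^ (2 * M) = x at *
    generalize (q : ℝ) ^ (2 * (n - 1)) = z at *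
    linear_combination (1 - q ^ 4 * x * (q ^ 2 * z)) * a2
      - (q * (q ^ 2 * z - q ^ 2 * x)) * a1 + q * x * b3 + (1 + q ^ 4 * x ^ 2) * b2 + q ^ 3 * x * b1

lemma kk_rel_nat (q : ℝ≥0) (hq : 0 < q) (M n : ℕ) :
    kk q M ((n + 1 : ℕ) : ℤ) * (1 - (q : ℝ) ^ (2 * M + 2 + 2 * n))
      = kk q M n * ((q : ℝ) ^ (2 * n + 1) - (q : ℝ) ^ (2 * M + 1)) := by
  have := kk_rel q hq M n
  have e : (q : ℝ) ^ (2 * (n : ℤ)) = (q : ℝ) ^ (2 * n) := by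
    rw [← zpow_natCast]; push_cast; rfl
  rw [e] at this
  push_cast
  rw [pow_add _ (2 * M + 2), this]
  ring

lemma kk_upper_nat (q : ℝ≥0) (hq : 0 < q) (hq1 : q < 1) (M n : ℕ) :
    kk q M n ≤ (q : ℝ) ^ (n ^ 2) * kk q M 0 := by
  have h0 : (0 : ℝ) < q := hq
  have h1 : (q : ℝ) < 1 := hq1
  induction n with
  | zero => simp
  | succ n ih =>
    have hD : 0 < 1 - (q : ℝ) ^ (2 * M + 2 + 2 * n) := by
      have : (q : ℝ) ^ (2 * M + 2 + 2 * n) < 1 := pow_lt_one₀ h0.le h1 (by omega)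
      linarith
    have h2 : kk q M ((n + 1 : ℕ) : ℤ) ≤ (q : ℝ) ^ (2 * n + 1) * kk q M n := by
      refine le_of_mul_le_mul_right ?_ hD
      rw [kk_rel_nat q hq]
      have h3 : (q : ℝ) ^ (2 * n + 1) * (q : ℝ) ^ (2 * M + 2 + 2 * n) ≤ (q : ℝ) ^ (2 * M + 1) := by
        rw [← pow_add]
        exact pow_le_pow_of_le_one h0.le h1.le (by omega)
      nlinarith [kk_nonneg q M n]
    calc _ ≤ (q : ℝ) ^ (2 * n + 1) * kk q M n := h2
      _ ≤ (q : ℝ) ^ (2 * n + 1) * ((q : ℝ) ^ (n ^ 2) * kk q M 0) := by gcongr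
      _ = _ := by ring

lemma kk_natAbs (q : ℝ≥0) (M : ℕ) (n : ℤ) : kk q M n = kk q M n.natAbs := by
  rcases Int.natAbs_eq n with h | h
  · rw [← h]
  · nth_rewrite 1 [h]; rw [kk_symm]

lemma mass_fac (r : ℝ≥0) : mass ℤ (fac r) = 1 := by
  simp only [mass, fac, map_add, AddMonoidAlgebra.lift_single]
  simp only [MonoidHom.one_apply, smul_eq_mul, mul_one]
  have : (1 + r) ^ 2 ≠ 0 := by positivity
  field_simp
  ring

lemma kk_hasSum (q : ℝ≥0) (M : ℕ) : HasSum (kk q M) 1 := by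
  have h : mass ℤ (pker q M) = 1 := by simp [pker, map_prod, mass_fac]
  rw [mass_apply] at h
  have h2 : HasSum (kk q M) (∑ n ∈ (pker q M).coeff.support, kk q M n) := by
    apply hasSum_sum_of_ne_finset_zero
    intro n hn
    simp at hn
    simp [kk, hn]
  convert h2
  simp only [kk]
  exact_mod_cast h.symm

noncomputable def th (q : ℝ≥0) : ℝ := ∑' n : ℤ, (q : ℝ) ^ (n.natAbs ^ 2)

lemma th_summable (q : ℝ≥0) (hq1 : q < 1) : Summable fun n : ℤ => (q : ℝ) ^ (n.natAbs ^ 2) := by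
  have h1 : (q : ℝ) < 1 := hq1
  have hs : Summable fun n : ℕ => (q : ℝ) ^ n := summable_geometric_of_lt_one q.2 h1
  have : Summable fun n : ℕ => (q : ℝ) ^ (n ^ 2) :=
    Summable.of_nonneg_of_le (fun n => by positivity)
      (fun n => pow_le_pow_of_le_one q.2 h1.le (by nlinarith [Nat.zero_le n, sq n, Nat.le_mul_self n])) hs
  apply Summable.of_nat_of_neg
  · simpa using this
  · simpa using this

lemma kk_zero_lower (q : ℝ≥0) (hq : 0 < q) (hq1 : q < 1) (M : ℕ) : 1 ≤ kk q M 0 * th q := by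
  rw [th, ← tsum_mul_left, ← (kk_hasSum q M).tsum_eq]
  refine Summable.tsum_le_tsum (fun n => ?_) (kk_hasSum q M).summable
    ((th_summable q hq1).mul_left _)
  rw [kk_natAbs, mul_comm]
  exact kk_upper_nat q hq hq1 M _

lemma th_pos (q : ℝ≥0) (hq1 : q < 1) : 0 < th q := by
  refine (th_summable q hq1).tsum_pos (fun n => by positivity) 0 (by simp)

lemma kk_lower (q : ℝ≥0) (hq : 0 < q) (hq1 : q < 1) (M n : ℕ) (h : n ≤ M) :
    (∏ i ∈ Finset.range n, ((q : ℝ) ^ (2 * i + 1) - (q : ℝ) ^ (2 * M + 1))) * kk q M 0 ≤ kk q M n := by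
  have h0 : (0 : ℝ) < q := hq
  have h1 : (q : ℝ) < 1 := hq1
  induction n with
  | zero => simp
  | succ n ih =>
    have h2 : kk q M n * ((q : ℝ) ^ (2 * n + 1) - (q : ℝ) ^ (2 * M + 1)) ≤ kk q M ((n + 1 : ℕ) : ℤ) := by
      rw [← kk_rel_nat q hq]
      have : 0 ≤ (q : ℝ) ^ (2 * M + 2 + 2 * n) := by positivity
      nlinarith [kk_nonneg q M ((n + 1 : ℕ) : ℤ)]
    have h3 : 0 ≤ (q : ℝ) ^ (2 * n + 1) - (q : ℝ) ^ (2 * M + 1) :=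
      sub_nonneg.2 (pow_le_pow_of_le_one h0.le h1.le (by omega))
    refine le_trans ?_ h2
    rw [Finset.prod_range_succ]
    nlinarith [mul_le_mul_of_nonneg_right (ih (by omega)) h3]

lemma kk_limit (q : ℝ≥0) (hq : 0 < q) (hq1 : q < 1) (n : ℤ) :
    ∃ c : ℕ → ℝ, Tendsto c atTop (𝓝 ((q : ℝ) ^ (n.natAbs ^ 2) / th q)) ∧
      ∀ᶠ M in atTop, 0 ≤ c M ∧ c M ≤ kk q M n := by
  have h0 : (0 : ℝ) < q := hq
  have h1 : (q : ℝ) < 1 := hq1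
  refine ⟨fun M => (∏ i ∈ Finset.range n.natAbs, ((q : ℝ) ^ (2 * i + 1) - (q : ℝ) ^ (2 * M + 1))) / th q,
    ?_, ?_⟩
  · apply Tendsto.div_const
    have e : (q : ℝ) ^ (n.natAbs ^ 2) = ∏ i ∈ Finset.range n.natAbs, ((q : ℝ) ^ (2 * i + 1) - 0) := by
      generalize n.natAbs = k
      induction k with
      | zero => simp
      | succ k ih => rw [Finset.prod_range_succ, ← ih]; ring
    rw [e]
    refine tendsto_finsetProd _ fun i _ => tendsto_const_nhds.sub ?_
    have := tendsto_pow_atTop_nhds_zero_of_lt_one h0.le h1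
    refine this.comp ?_
    exact tendsto_atTop_mono (fun M => by simp only [id]; omega) tendsto_id
  · filter_upwards [eventually_ge_atTop n.natAbs] with M hM
    have hp : 0 ≤ ∏ i ∈ Finset.range n.natAbs, ((q : ℝ) ^ (2 * i + 1) - (q : ℝ) ^ (2 * M + 1)) := by
      refine Finset.prod_nonneg fun i hi => ?_
      simp at hi
      exact sub_nonneg.2 (pow_le_pow_of_le_one h0.le h1.le (by omega))
    have ht := th_pos q hq1
    refine ⟨by positivity, ?_⟩
    rw [kk_natAbs]
    refine le_trans ?_ (kk_lower q hq hq1 M _ hM)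
    rw [div_le_iff₀ ht, mul_assoc]
    exact le_mul_of_one_le_right hp (kk_zero_lower q hq hq1 M)

end oned
section ddim
open Filter Topology
variable {d : ℕ}

noncomputable def emb (j : Fin d) : AddMonoidAlgebra ℝ≥0 ℤ →ₐ[ℝ≥0] AddMonoidAlgebra ℝ≥0 (Fin d → ℤ) :=
  AddMonoidAlgebra.mapDomainAlgHom ℝ≥0 ℝ≥0 (AddMonoidHom.single (fun _ : Fin d => ℤ) j)

lemma emb_single (j : Fin d) (a : ℤ) (r : ℝ≥0) :
    emb j (AddMonoidAlgebra.single a r) = AddMonoidAlgebra.single (Pi.single j a) r := by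
  simp only [emb, AddMonoidAlgebra.mapDomainAlgHom_apply, AddMonoidAlgebra.mapDomain_single]
  rfl

lemma rfx_single {E : Type} [AddCommGroup E] (a : E) (r : ℝ≥0) :
    rfx E (AddMonoidAlgebra.single a r) = AddMonoidAlgebra.single (-a) r := by
  simp only [rfx, AddMonoidAlgebra.mapDomainAlgHom_apply, AddMonoidAlgebra.mapDomain_single]
  rfl

lemma emb_eq_sum (j : Fin d) (x : AddMonoidAlgebra ℝ≥0 ℤ) :
    emb j x = ∑ a ∈ x.coeff.support, AddMonoidAlgebra.single (Pi.single j a) (x.coeff a) := by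
  simp [emb, AddMonoidAlgebra.mapDomain, Finsupp.mapDomain, Finsupp.sum,
    AddMonoidAlgebra.ofCoeff_sum]

lemma coeff_prod_emb (x : Fin d → AddMonoidAlgebra ℝ≥0 ℤ) (n : Fin d → ℤ) :
    (∏ j, emb j (x j)).coeff n = ∏ j, (x j).coeff (n j) := by
  simp_rw [emb_eq_sum]
  rw [Finset.prod_univ_sum, AddMonoidAlgebra.coeff_sum, Finset.sum_apply']
  have : ∀ a : Fin d → ℤ, (∏ j, AddMonoidAlgebra.single (Pi.single j (a j) : Fin d → ℤ) ((x j).coeff (a j)))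
      = AddMonoidAlgebra.single a (∏ j, (x j).coeff (a j)) := by
    intro a
    rw [AddMonoidAlgebra.prod_single, Finset.univ_sum_single]
  simp_rw [this, AddMonoidAlgebra.coeff_single, Finsupp.single_apply]
  rw [Finset.sum_ite_eq']
  split_ifs with h
  · rfl
  · simp at h
    obtain ⟨j, hj⟩ := h
    exact (Finset.prod_eq_zero (Finset.mem_univ j) hj).symm

lemma mass_emb (j : Fin d) (x : AddMonoidAlgebra ℝ≥0 ℤ) : mass _ (emb j x) = mass ℤ x := by
  rw [mass_apply x, emb_eq_sum, map_sum]
  simp [mass]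

noncomputable def hh0 : AddMonoidAlgebra ℝ≥0 ℤ :=
  AddMonoidAlgebra.single 0 (1 / 2) + AddMonoidAlgebra.single 1 (1 / 2)

lemma mass_hh0 : mass ℤ hh0 = 1 := by
  simp only [mass, hh0, map_add, AddMonoidAlgebra.lift_single]
  simp only [MonoidHom.one_apply, smul_eq_mul, mul_one]
  norm_num

noncomputable def aa (r : ℝ≥0) : ℝ≥0 := 4 * r / (1 + r) ^ 2

lemma aa_le_one (r : ℝ≥0) : aa r ≤ 1 := by
  rw [aa, div_le_one (by positivity), ← NNReal.coe_le_coe]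
  push_cast
  nlinarith [sq_nonneg (1 - (r : ℝ))]

lemma aa_mono {r s : ℝ≥0} (h : r ≤ s) (hs : s ≤ 1) : aa r ≤ aa s := by
  rw [aa, aa, div_le_div_iff₀ (by positivity) (by positivity), ← NNReal.coe_le_coe]
  have h1 : (r : ℝ) ≤ s := h
  have h2 : (s : ℝ) ≤ 1 := hs
  have h0 : (0 : ℝ) ≤ r := r.2
  push_cast
  have : (0 : ℝ) ≤ 4 * (s - r) * (1 - r * s) := by
    have : (r : ℝ) * s ≤ 1 := by nlinarith
    exact mul_nonneg (by linarith) (by linarith)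
  nlinarith

lemma emb_fac (j : Fin d) (r : ℝ≥0) :
    emb j (fac r) = aa r • (emb j hh0 * rfx _ (emb j hh0)) + (1 - aa r) • 1 := by
  have e : rfx _ (emb j hh0) = emb j (AddMonoidAlgebra.single 0 (1 / 2) + AddMonoidAlgebra.single (-1) (1 / 2)) := by
    simp only [hh0, map_add, emb_single, rfx_single, Pi.single_neg, neg_zero, Pi.single_zero]
  rw [e, ← map_mul, ← map_one (emb j), ← map_smul, ← map_smul, ← map_add]
  congr 1
  have h2 : ((1 - aa r : ℝ≥0) : ℝ) = 1 - 4 * r / (1 + r) ^ 2 := by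
    rw [NNReal.coe_sub (aa_le_one r), aa]; push_cast; rfl
  have hne : (1 + (r : ℝ)) ≠ 0 := by positivity
  simp only [fac, hh0, mul_add, add_mul, AddMonoidAlgebra.single_mul_single, AddMonoidAlgebra.one_def,
    smul_add, AddMonoidAlgebra.smul_single]
  have e1 : r / (1 + r) ^ 2 = aa r * (1 / 2 * (1 / 2)) := by
    rw [aa]; field_simp; norm_num
  have e2 : (1 + r ^ 2) / (1 + r) ^ 2 = aa r * (1 / 2 * (1 / 2)) + aa r * (1 / 2 * (1 / 2)) + (1 - aa r) := by
    rw [← NNReal.coe_inj]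
    push_cast
    rw [h2, aa]
    push_cast
    field_simp
    ring
  rw [e2, e1]
  simp only [smul_eq_mul, mul_one, add_zero, zero_add, AddMonoidAlgebra.single_add,
    show (1 : ℤ) + -1 = 0 by norm_num]
  abel

noncomputable def wt (b : ℕ → ℝ≥0) (K s : ℕ) : ℝ≥0 := if s < K then b (s + 1) - b s else 1 - b K

lemma wt_sum {R : Type} [AddCommMonoid R] [Module ℝ≥0 R] (b : ℕ → ℝ≥0) (hb : Monotone b) (hb0 : b 0 = 0)
    (hb1 : ∀ k, b k ≤ 1) (K k : ℕ) (hk : k ≤ K) (x y : R) :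
    ∑ s ∈ Finset.range (K + 1), wt b K s • (if s < k then x else y) = b k • x + (1 - b k) • y := by
  rw [Finset.sum_range_succ]
  have e : ∑ s ∈ Finset.range K, wt b K s • (if s < k then x else y)
      = ∑ s ∈ Finset.range K, (b (s + 1) - b s) • (if s < k then x else y) := by
    refine Finset.sum_congr rfl fun s hs => ?_
    simp at hs
    simp [wt, hs]
  rw [e]
  have e' : wt b K K • (if K < k then x else y) = (1 - b K) • y := by
    simp [wt, not_lt.2 hk]
  rw [e']
  clear e e'
  induction K, hk using Nat.le_induction with
  | base =>
    congr 1
    rw [Finset.sum_congr rfl (g := fun s => (b (s + 1) - b s) • x)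
      (fun s hs => by simp at hs; simp [hs]), ← Finset.sum_smul, Finset.sum_range_tsub hb, hb0, tsub_zero]
  | succ K hk ih =>
    rw [Finset.sum_range_succ, ← ih, if_neg (by omega), add_assoc, ← add_smul]
    congr 2
    rw [add_comm]
    exact tsub_add_tsub_cancel (hb1 _) (hb (by omega))

lemma ddim_bound {p : ℝ} (hp : 1 < p) (K M : ℕ) (q : ℕ → ℝ≥0) (hq : Monotone q) (hq0 : q 0 = 0)
    (hq1 : ∀ k, q k < 1) (f : (Fin d → ℤ) → ℝ≥0∞) (hf : ∑' x, f x ≠ ⊤) :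
    ∑' x, (⨆ k ∈ Finset.range (K + 1), act _ (∏ j, emb j (pker (q k) M)) f x) ^ p
      ≤ cst p * ∑' x, f x ^ p := by
  set b : Fin d × Fin M → ℕ → ℝ≥0 := fun i k => aa (q k ^ (2 * (i.2 : ℕ) + 1)) with hb
  have hbm : ∀ i, Monotone (b i) := fun i k l hkl =>
    aa_mono (pow_le_pow_left₀ zero_le (hq hkl) _) (pow_le_one₀ zero_le (hq1 l).le)
  have hb0 : ∀ i, b i 0 = 0 := fun i => by simp [hb, hq0, aa]
  have hb1 : ∀ i k, b i k ≤ 1 := fun i k => aa_le_one _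
  have := mix hp K (I := Fin d × Fin M) (fun i => emb i.1 hh0)
    (fun i => by rw [mass_emb, mass_hh0]) (fun i => wt (b i) K)
    (fun i => by
      have := wt_sum (R := ℝ≥0) (b i) (hbm i) (hb0 i) (hb1 i) K 0 (by omega) 1 1
      simpa [hb0] using this) f hf
  refine le_trans (le_of_eq ?_) this
  refine tsum_congr fun x => ?_
  congr 1
  refine iSup_congr fun k => iSup_congr fun hk => ?_
  have e : (∏ j, emb j (pker (q k) M)) = ∏ i : Fin d × Fin M, ∑ s ∈ Finset.range (K + 1),
      wt (b i) K s • (if s < k then emb i.1 hh0 * rfx _ (emb i.1 hh0) else 1) := by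
    rw [Fintype.prod_prod_type]
    refine Finset.prod_congr rfl fun j _ => ?_
    rw [pker, map_prod, Finset.prod_range]
    refine Finset.prod_congr rfl fun m _ => ?_
    rw [wt_sum (b (j, m)) (hbm _) (hb0 _) (hb1 _) K k (by simp at hk; omega), emb_fac]
  rw [e]

lemma sort_times (Q : Finset ℝ≥0) (hQ : ∀ x ∈ Q, x < 1) :
    ∃ (K : ℕ) (q : ℕ → ℝ≥0), Monotone q ∧ q 0 = 0 ∧ (∀ k, q k = 0 ∨ q k ∈ Q) ∧
      ∀ x ∈ Q, ∃ k ≤ K, q k = x := by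
  induction Q using Finset.induction_on_max with
  | empty => exact ⟨0, fun _ => 0, monotone_const, rfl, by simp, by simp⟩
  | insert a s ha ih =>
    obtain ⟨K, q, h1, h2, h3, h4⟩ := ih (fun x hx => hQ x (by simp [hx]))
    have hqa : ∀ k, q k ≤ a := fun k => by
      rcases h3 k with h | h
      · rw [h]; exact zero_le
      · exact (ha _ h).le
    refine ⟨K + 1, fun k => if k ≤ K then q k else a, ?_, by simp [h2], ?_, ?_⟩
    · intro k l hkl
      dsimp only
      split_ifs with u v v
      · exact h1 hkl
      · exact hqa k
      · omega
      · exact le_rfl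
    · intro k
      dsimp only
      split_ifs with u
      · rcases h3 k with h | h
        · exact Or.inl h
        · exact Or.inr (by simp [h])
      · exact Or.inr (by simp)
    · intro x hx
      rw [Finset.mem_insert] at hx
      rcases hx with rfl | hx
      · exact ⟨K + 1, le_rfl, by simp⟩
      · obtain ⟨k, hk, e⟩ := h4 x hx
        exact ⟨k, by omega, by simp [hk, e]⟩

/-- nome -/
noncomputable def qq (t : ℝ) : ℝ≥0 := ⟨Real.exp (-π / t), (Real.exp_pos _).le⟩

lemma qq_pos (t : ℝ) : 0 < qq t := Real.exp_pos _

lemma qq_lt_one (t : ℝ) (ht : 0 < t) : qq t < 1 := by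
  have : Real.exp (-π / t) < 1 := by
    rw [Real.exp_lt_one_iff, neg_div]
    have := Real.pi_pos
    have : 0 < π / t := by positivity
    linarith
  exact this

lemma qq_pow (t : ℝ) (n : ℤ) : (qq t : ℝ) ^ (n.natAbs ^ 2) = Real.exp (-π * (n : ℝ) ^ 2 / t) := by
  have : (qq t : ℝ) = Real.exp (-π / t) := rfl
  rw [this, ← Real.exp_nat_mul]
  congr 1
  have : ((n.natAbs ^ 2 : ℕ) : ℝ) = (n : ℝ) ^ 2 := by
    have h : ((n.natAbs ^ 2 : ℕ) : ℤ) = n ^ 2 := by push_cast; exact sq_abs n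
    rw [← Int.cast_natCast, h]; push_cast; rfl
  rw [this]; ring

lemma gauss_eq (t : ℝ) (n : Fin d → ℤ) :
    gauss d t n = ∏ j, ((qq t : ℝ) ^ ((n j).natAbs ^ 2) / th (qq t)) := by
  have h1 : theta (1 / t) 0 = th (qq t) := by
    rw [theta, th]
    refine tsum_congr fun k => ?_
    rw [qq_pow]; congr 1; ring
  have e1 : (∏ j, theta (1 / t) ((0 : Fin d → ℝ) j)) = ∏ j : Fin d, th (qq t) :=
    Finset.prod_congr rfl fun j _ => by rw [Pi.zero_apply, h1]
  have e2 : ∏ j, (qq t : ℝ) ^ ((n j).natAbs ^ 2) = Real.exp (-π * (∑ j, (n j : ℝ) ^ 2) / t) := by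
    simp_rw [qq_pow]
    rw [← Real.exp_sum, Finset.mul_sum, Finset.sum_div]
  rw [gauss, bigTheta, Finset.prod_div_distrib, e1, e2, div_eq_inv_mul (Real.exp _)]

lemma gauss_ev (t : ℝ) (ht : 0 < t) (n : Fin d → ℤ) :
    ∀ᶠ M in atTop, gauss d t n ≤ 2 * ∏ j, kk (qq t) M (n j) := by
  choose c hc1 hc2 using fun j => kk_limit (qq t) (qq_pos t) (qq_lt_one t ht) (n j)
  have hlim := tendsto_finsetProd Finset.univ (fun j _ => hc1 j)
  rw [← gauss_eq] at hlim
  have hpos : 0 < gauss d t n := by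
    rw [gauss_eq]
    refine Finset.prod_pos fun j _ => ?_
    have := th_pos _ (qq_lt_one t ht)
    have := qq_pos t
    positivity
  have h1 := hlim.eventually_const_le (show gauss d t n / 2 < gauss d t n by linarith)
  filter_upwards [h1, eventually_all.2 hc2] with M h1 h2
  have : ∏ j, c j M ≤ ∏ j, kk (qq t) M (n j) :=
    Finset.prod_le_prod (fun j _ => (h2 j).1) (fun j _ => (h2 j).2)
  linarith

lemma fin_bound {p : ℝ} (hp : 1 < p) (φ : (Fin d → ℤ) → ℝ≥0∞) (hφ : ∀ x, φ x ≠ ⊤)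
    (J : Finset ({s : ℝ // 0 < s} × Finset (Fin d → ℤ))) (X : Finset (Fin d → ℤ)) :
    ∑ x ∈ X, (⨆ i ∈ J, ∑ n ∈ i.2, ENNReal.ofReal (gauss d i.1 n) * φ (x - n)) ^ p
      ≤ (2 ^ p * cst p) * ∑' x, φ x ^ p := by
  classical
  have hp0 : 0 < p := by linarith
  obtain ⟨K, q, h1, h2, h3, h4⟩ := sort_times (J.image fun i => qq i.1) (by
    intro x hx
    simp only [Finset.mem_image] at hx
    obtain ⟨i, _, rfl⟩ := hx
    exact qq_lt_one _ i.1.2)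
  have hq1 : ∀ k, q k < 1 := by
    intro k
    rcases h3 k with h | h
    · rw [h]; exact zero_lt_one
    · simp only [Finset.mem_image] at h
      obtain ⟨i, _, h⟩ := h
      rw [← h]; exact qq_lt_one _ i.1.2
  have hev : ∀ᶠ M in atTop, ∀ i ∈ J, ∀ n ∈ i.2, gauss d i.1 n ≤ 2 * ∏ j, kk (qq i.1) M (n j) := by
    rw [Filter.eventually_all_finset]
    intro i hi
    rw [Filter.eventually_all_finset]
    intro n hn
    exact gauss_ev _ i.1.2 n
  obtain ⟨M, hM⟩ := hev.exists
  set Y : Finset (Fin d → ℤ) := J.biUnion fun i => i.2.biUnion fun n => X.image fun x => x - n with hY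
  set f : (Fin d → ℤ) → ℝ≥0∞ := fun x => if x ∈ Y then φ x else 0 with hf
  have hfφ : ∀ x, f x ≤ φ x := fun x => by simp only [hf]; split_ifs <;> simp
  have hfs : ∑' x, f x ≠ ⊤ := by
    rw [tsum_eq_sum (s := Y) (by intro x hx; simp [hf, hx])]
    rw [ENNReal.sum_ne_top]
    intro x _
    exact ne_top_of_le_ne_top (hφ x) (hfφ x)
  have key := ddim_bound hp K M q h1 h2 hq1 f hfs
  have step : ∀ x ∈ X, (⨆ i ∈ J, ∑ n ∈ i.2, ENNReal.ofReal (gauss d i.1 n) * φ (x - n))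
      ≤ 2 * ⨆ k ∈ Finset.range (K + 1), act _ (∏ j, emb j (pker (q k) M)) f x := by
    intro x hx
    refine iSup₂_le fun i hi => ?_
    obtain ⟨k, hk, hki⟩ := h4 (qq i.1) (Finset.mem_image_of_mem _ hi)
    calc ∑ n ∈ i.2, ENNReal.ofReal (gauss d i.1 n) * φ (x - n)
        ≤ ∑ n ∈ i.2, 2 * (((∏ j, emb j (pker (q k) M)).coeff n : ℝ≥0∞) * f (x - n)) := by
          refine Finset.sum_le_sum fun n hn => ?_
          have hmem : x - n ∈ Y := by
            simp only [hY, Finset.mem_biUnion, Finset.mem_image]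
            exact ⟨i, hi, n, hn, x, hx, rfl⟩
          have hfe : f (x - n) = φ (x - n) := by simp [hf, hmem]
          rw [hfe, ← mul_assoc]
          gcongr
          rw [coeff_prod_emb, hki]
          refine (ENNReal.ofReal_le_ofReal (hM i hi n hn)).trans (le_of_eq ?_)
          have : (∏ j, kk (qq i.1) M (n j)) = ((∏ j, (pker (qq i.1) M).coeff (n j) : ℝ≥0) : ℝ) := by
            simp [kk]
          rw [this, ENNReal.ofReal_mul (by norm_num), ENNReal.ofReal_coe_nnreal]
          simp
      _ = 2 * ∑ n ∈ i.2, (((∏ j, emb j (pker (q k) M)).coeff n : ℝ≥0∞) * f (x - n)) := by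
          rw [Finset.mul_sum]
      _ ≤ _ := by
          refine mul_le_mul_right ?_ _
          refine (act_ge _ f x i.2).trans ?_
          exact le_iSup₂ (f := fun k (_ : k ∈ Finset.range (K + 1)) =>
            act _ (∏ j, emb j (pker (q k) M)) f x) k (by simp; omega)
  calc _ ≤ ∑ x ∈ X, (2 * ⨆ k ∈ Finset.range (K + 1), act _ (∏ j, emb j (pker (q k) M)) f x) ^ p := by
        refine Finset.sum_le_sum fun x hx => ENNReal.rpow_le_rpow (step x hx) hp0.le
    _ = 2 ^ p * ∑ x ∈ X, (⨆ k ∈ Finset.range (K + 1), act _ (∏ j, emb j (pker (q k) M)) f x) ^ p := by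
        simp_rw [ENNReal.mul_rpow_of_nonneg _ _ hp0.le, Finset.mul_sum]
    _ ≤ 2 ^ p * (cst p * ∑' x, φ x ^ p) := by
        refine mul_le_mul_right ?_ _
        refine (ENNReal.sum_le_tsum X).trans (key.trans ?_)
        refine mul_le_mul_right ?_ _
        exact ENNReal.tsum_le_tsum fun x => ENNReal.rpow_le_rpow (hfφ x) hp0.le
    _ = _ := by rw [mul_assoc]

lemma iSup_rpow' {p : ℝ} (hp : 0 < p) {ι : Type} (h : ι → ℝ≥0∞) : (⨆ i, h i) ^ p = ⨆ i, h i ^ p :=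
  (ENNReal.orderIsoRpow p hp).map_iSup h

lemma full_bound {p : ℝ} (hp : 1 < p) (f : (Fin d → ℤ) → ℂ) :
    ∑' x, (⨆ t : {s : ℝ // 0 < s}, (‖gConv d (t : ℝ) f x‖₊ : ℝ≥0∞)) ^ p
      ≤ (2 ^ p * cst p) * ∑' x, (‖f x‖₊ : ℝ≥0∞) ^ p := by
  have hp0 : 0 < p := by linarith
  set h : ({s : ℝ // 0 < s} × Finset (Fin d → ℤ)) → (Fin d → ℤ) → ℝ≥0∞ := fun i x =>
    ∑ n ∈ i.2, ENNReal.ofReal (gauss d i.1 n) * (‖f (x - n)‖₊ : ℝ≥0∞) with hh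
  have h1 : ∀ x, (⨆ t : {s : ℝ // 0 < s}, (‖gConv d (t : ℝ) f x‖₊ : ℝ≥0∞)) ≤ ⨆ i, h i x := by
    intro x
    refine iSup_le fun t => ?_
    have hg : ∀ n, 0 ≤ gauss d t n := fun n => by
      rw [gauss_eq]
      exact Finset.prod_nonneg fun j _ => div_nonneg (by positivity) (th_pos _ (qq_lt_one _ t.2)).le
    calc (‖gConv d (t : ℝ) f x‖₊ : ℝ≥0∞) = ‖gConv d (t : ℝ) f x‖ₑ := rfl
      _ ≤ ∑' n, ‖(gauss d t n : ℂ) * f (x - n)‖ₑ := enorm_tsum_le_tsum_enorm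
      _ = ∑' n, ENNReal.ofReal (gauss d t n) * (‖f (x - n)‖₊ : ℝ≥0∞) := by
          refine tsum_congr fun n => ?_
          rw [enorm_mul]
          congr 1
          rw [← ofReal_norm, Complex.norm_real, Real.norm_of_nonneg (hg n)]
      _ = ⨆ N : Finset (Fin d → ℤ), h (t, N) x := ENNReal.tsum_eq_iSup_sum
      _ ≤ _ := iSup_le fun N => le_iSup (fun i => h i x) (t, N)
  refine (ENNReal.tsum_le_tsum fun x => ENNReal.rpow_le_rpow (h1 x) hp0.le).trans ?_
  rw [ENNReal.tsum_eq_iSup_sum]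
  refine iSup_le fun X => ?_
  have e : ∀ x, (⨆ i, h i x) ^ p = ⨆ J : Finset _, (⨆ i ∈ J, h i x) ^ p := fun x => by
    rw [iSup_eq_iSup_finset, iSup_rpow' hp0]
  rw [Finset.sum_congr rfl fun x _ => e x]
  rw [ENNReal.finsetSum_iSup_of_monotone]
  · refine iSup_le fun J => ?_
    exact fin_bound hp (fun x => (‖f x‖₊ : ℝ≥0∞)) (fun x => ENNReal.coe_ne_top) J X
  · intro x J J' hJ
    refine ENNReal.rpow_le_rpow ?_ hp0.le
    exact biSup_mono fun i hi => hJ hi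

end ddim
end MG

/-- Dimension-free ℓ^p bound for the maximal function of the discrete Gaussian semigroup-like
family `G_t`: for each `p ∈ (1,∞)` there is `C_p > 0`, independent of the dimension `d`, with
`‖sup_{t>0} |G_t f|‖_{ℓ^p} ≤ C_p ‖f‖_{ℓ^p}` for all `f ∈ ℓ^p(ℤ^d)`. -/
theorem maximal_gauss_dimension_free (p : ℝ) (hp : 1 < p) :
    ∃ C : ℝ, 0 < C ∧ ∀ d : ℕ, 0 < d → ∀ f : (Fin d → ℤ) → ℂ,
      lpNorm d p (fun x => (‖f x‖₊ : ℝ≥0∞)) < ⊤ →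
      lpNorm d p (fun x => ⨆ t : {s : ℝ // 0 < s}, (‖gConv d (t : ℝ) f x‖₊ : ℝ≥0∞))
        ≤ ENNReal.ofReal C * lpNorm d p (fun x => (‖f x‖₊ : ℝ≥0∞)) := by
  have hp0 : 0 < p := by linarith
  have hD : ((2 ^ p * MG.cst p) ^ (1 / p) : ℝ≥0∞) ≠ ⊤ :=
    ENNReal.rpow_ne_top_of_nonneg (by positivity)
      (ENNReal.mul_ne_top (ENNReal.rpow_ne_top_of_nonneg hp0.le (by simp)) (MG.cst_ne_top hp))
  refine ⟨((2 ^ p * MG.cst p) ^ (1 / p) : ℝ≥0∞).toReal + 1,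
    add_pos_of_nonneg_of_pos ENNReal.toReal_nonneg one_pos, ?_⟩
  intro d _ f _
  calc _ ≤ ((2 ^ p * MG.cst p) * ∑' x, (‖f x‖₊ : ℝ≥0∞) ^ p) ^ (1 / p) :=
        ENNReal.rpow_le_rpow (MG.full_bound hp f) (by positivity)
    _ = (2 ^ p * MG.cst p) ^ (1 / p) * lpNorm d p (fun x => (‖f x‖₊ : ℝ≥0∞)) := by
        rw [ENNReal.mul_rpow_of_nonneg _ _ (by positivity)]; rfl
    _ ≤ _ := by
        refine mul_le_mul_left ?_ _
        rw [ENNReal.ofReal_add ENNReal.toReal_nonneg zero_le_one, ENNReal.ofReal_toReal hD]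
        exact le_self_add
end

section
/- For each p ∈ (1,∞) there exists a constant C_p > 0, independent of the dimension d ∈ ℤ_+, such that for every d ∈ ℤ_+ and every f ∈ ℓ^p(ℤ^d) one has sup_{λ>0} ‖ λ · N_λ(G_t f : t>0)^{1/2} ‖_{ℓ^p(ℤ^d)} ≤ C_p ‖f‖_{ℓ^p(ℤ^d)}. -/
open scoped ENNReal Real BigOperators
open Real

/-- The λ-jump counting function `N_λ(a_t : t ∈ I)`: the supremum of all `J ∈ ℕ` such that there
exist `t_0 < t_1 < … < t_J` in `I` with `|a_{t_{j+1}} - a_{t_j}| ≥ λ` for all `0 ≤ j ≤ J-1`. -/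
noncomputable def jumpCount (a : ℝ → ℂ) (I : Set ℝ) (lam : ℝ) : ℝ≥0∞ :=
  ⨆ (J : ℕ) (_ : ∃ u : Fin (J + 1) → ℝ, StrictMono u ∧ (∀ j, u j ∈ I) ∧
      ∀ j : Fin J, lam ≤ ‖a (u j.succ) - a (u j.castSucc)‖), (J : ℝ≥0∞)


section JGBellman
variable {V : Type*} [AddCommGroup V]

/-- Smoothed functions. -/
noncomputable def jgM (h : ℕ → V) (F : V → ℝ) : ℕ → V → ℝ
  | 0, y => F y
  | (n+1), y => (jgM h F n y + jgM h F n (y - h n)) / 2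

/-- Displacement. -/
noncomputable def jgS (h : ℕ → V) (A : Finset ℕ) (n : ℕ) : V :=
  ∑ s ∈ Finset.range n, if s ∈ A then h s else 0

/-- Run a state machine downwards. -/
def jgRun {σ : Type*} (upd : σ → ℝ → σ) (z : ℕ → ℝ) : ℕ → σ → σ
  | 0, s => s
  | (n+1), s => jgRun upd z n (upd s (z n))

theorem jgRun_congr {σ : Type*} (upd : σ → ℝ → σ) (z z' : ℕ → ℝ) (n : ℕ)
    (h : ∀ i < n, z i = z' i) (s : σ) : jgRun upd z n s = jgRun upd z' n s := by
  induction n generalizing s with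
  | zero => rfl
  | succ n ih =>
    simp only [jgRun]
    rw [h n (by omega)]
    exact ih (fun i hi => h i (by omega)) _

theorem jgM_nonneg (h : ℕ → V) (F : V → ℝ) (hF : ∀ y, 0 ≤ F y) (n : ℕ) (y : V) :
    0 ≤ jgM h F n y := by
  induction n generalizing y with
  | zero => exact hF y
  | succ n ih => simp only [jgM]; have := ih y; have := ih (y - h n); positivity

theorem jgS_insert (h : ℕ → V) (A : Finset ℕ) (n i : ℕ) (hi : i ≤ n) :
    jgS h (insert n A) i = jgS h A i := by
  unfold jgS
  apply Finset.sum_congr rfl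
  intro s hs
  have : s ≠ n := by have := Finset.mem_range.1 hs; omega
  simp [this]

theorem jgS_succ_not (h : ℕ → V) (A : Finset ℕ) (n : ℕ) (hA : n ∉ A) :
    jgS h A (n+1) = jgS h A n := by
  unfold jgS
  rw [Finset.sum_range_succ]; simp [hA]

theorem jgS_succ_insert (h : ℕ → V) (A : Finset ℕ) (n : ℕ) :
    jgS h (insert n A) (n+1) = jgS h A n + h n := by
  have := jgS_insert h A n n le_rfl
  unfold jgS at *
  rw [Finset.sum_range_succ, this]; simp

theorem jg_bellman {σ : Type*} (upd : σ → ℝ → σ) (inv : σ → Prop) (B G : ℝ → σ → ℝ)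
    (h1 : ∀ s x, inv s → 0 ≤ x → inv (upd s x) ∧ B x (upd s x) ≤ B x s)
    (h2 : ∀ s x y, B ((x+y)/2) s = (B x s + B y s)/2)
    (h3 : ∀ s x, inv s → 0 ≤ x → G x s ≤ B x s)
    (h : ℕ → V) (F : V → ℝ) (hF : ∀ y, 0 ≤ F y) (n : ℕ) (y : V) (s : σ) (hs : inv s) :
    ∑ A ∈ (Finset.range n).powerset, G (F (y - jgS h A n))
      (jgRun upd (fun i => jgM h F i (y - jgS h A n + jgS h A i)) n s)
      ≤ 2 ^ n * B (jgM h F n y) s := by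
  induction n generalizing y s with
  | zero => simpa [jgS, jgRun, jgM] using h3 s (F y) hs (hF y)
  | succ n ih =>
    rw [Finset.range_add_one, Finset.sum_powerset_insert (by simp)]
    have e1 : ∀ A ∈ (Finset.range n).powerset, n ∉ A := by
      intro A hA hn
      have := Finset.mem_powerset.1 hA hn
      simp at this
    have a1 : ∑ A ∈ (Finset.range n).powerset, G (F (y - jgS h A (n+1)))
      (jgRun upd (fun i => jgM h F i (y - jgS h A (n+1) + jgS h A i)) (n+1) s)
       ≤ 2 ^ n * B (jgM h F n y) s := by
      have hn := jgM_nonneg h F hF n y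
      obtain ⟨i1, i2⟩ := h1 s _ hs hn
      refine le_trans (le_of_eq ?_) ((ih y (upd s (jgM h F n y)) i1).trans
        (mul_le_mul_of_nonneg_left i2 (by positivity)))
      apply Finset.sum_congr rfl
      intro A hA
      rw [jgS_succ_not h A n (e1 A hA)]
      simp only [jgRun]
      simp
    have a2 : ∑ A ∈ (Finset.range n).powerset, G (F (y - jgS h (insert n A) (n+1)))
      (jgRun upd (fun i => jgM h F i (y - jgS h (insert n A) (n+1) + jgS h (insert n A) i)) (n+1) s)
       ≤ 2 ^ n * B (jgM h F n (y - h n)) s := by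
      have hn := jgM_nonneg h F hF n (y - h n)
      obtain ⟨i1, i2⟩ := h1 s _ hs hn
      refine le_trans (le_of_eq ?_) ((ih (y - h n) (upd s (jgM h F n (y - h n))) i1).trans
        (mul_le_mul_of_nonneg_left i2 (by positivity)))
      apply Finset.sum_congr rfl
      intro A hA
      rw [jgS_succ_insert h A n]
      simp only [jgRun]
      rw [jgS_insert h A n n le_rfl]
      have e2 : y - (jgS h A n + h n) = y - h n - jgS h A n := by abel
      rw [e2]
      congr 1
      rw [sub_add_cancel]
      apply jgRun_congr
      intro i hi
      rw [jgS_insert h A n i hi.le]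
    calc _ ≤ _ := add_le_add a1 a2
      _ = _ := by
        simp only [jgM]
        rw [h2]; ring

/-- greedy update; state is (reference, count, max). -/
noncomputable def jgUpd (s : ℝ × ℕ × ℝ) (x : ℝ) : ℝ × ℕ × ℝ :=
  if 1 ≤ |x - s.1| then (x, s.2.1 + 1, max s.2.2 x) else s

/-- greedy count for a path read from level `n` downwards. -/
noncomputable def jgK (z : ℕ → ℝ) (n : ℕ) : ℕ := (jgRun jgUpd z n (z n, 0, z n)).2.1

/-- invariant -/
def jgInv (s : ℝ × ℕ × ℝ) : Prop := 0 ≤ s.1 ∧ s.1 ≤ s.2.2 ∧ (s.2.1 ≠ 0 → 1 ≤ s.2.2)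

theorem jgInv_upd (s : ℝ × ℕ × ℝ) (x : ℝ) (hs : jgInv s) (hx : 0 ≤ x) : jgInv (jgUpd s x) := by
  unfold jgUpd
  split_ifs with hc
  · obtain ⟨a, b, c⟩ := hs
    refine ⟨hx, le_max_right _ _, fun _ => ?_⟩
    rcases le_abs.1 hc with h | h
    · exact le_max_of_le_right (by linarith)
    · exact le_max_of_le_left (by linarith)
  · exact hs

theorem jg_young (p : ℝ) (hp : 1 ≤ p) (ε : ℝ) (hε : 0 < ε) (x m : ℝ) (hx : 0 ≤ x) (hm : 0 ≤ m) :
    x * m ^ (p-1) ≤ ε * m ^ p + ε ^ (1-p) * x ^ p := by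
  have e : ∀ t : ℝ, 0 ≤ t → t * t ^ (p-1) = t ^ p := by
    intro t ht
    rcases ht.eq_or_lt with rfl | h0
    · rw [zero_mul, Real.zero_rpow (by linarith)]
    · nth_rewrite 1 [← Real.rpow_one t]
      rw [← Real.rpow_add h0]; congr 1; ring
  rcases le_total x (ε * m) with h | h
  · calc x * m ^ (p-1) ≤ ε * m * m ^ (p-1) := by gcongr
      _ = ε * m ^ p := by rw [mul_assoc, e m hm]
      _ ≤ _ := by
        have : 0 ≤ ε ^ (1-p) * x ^ p := by positivity
        linarith
  · have h' : m ≤ x / ε := by rw [le_div_iff₀ hε]; linarith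
    calc x * m ^ (p-1) ≤ x * (x / ε) ^ (p-1) := by
          gcongr
      _ = ε ^ (1-p) * x ^ p := by
        rw [Real.div_rpow hx hε.le, ← e x hx]
        rw [show (1-p) = -(p-1) by ring, Real.rpow_neg hε.le]
        field_simp
      _ ≤ _ := by
        have : 0 ≤ ε * m ^ p := by positivity
        linarith

/-- Doob potential monotonicity. -/
theorem jg_doob (p : ℝ) (hp : 1 < p) (x m : ℝ) (hx : 0 ≤ x) (hm : 0 ≤ m) :
    (max m x) ^ p - p/(p-1) * x * (max m x) ^ (p-1) ≤ m ^ p - p/(p-1) * x * m ^ (p-1) := by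
  rcases le_total x m with h | h
  · rw [max_eq_left h]
  · rw [max_eq_right h]
    have hp1 : 0 < p - 1 := by linarith
    have e : x * x ^ (p-1) = x ^ p := by
      rcases hx.eq_or_lt with rfl | h0
      · rw [zero_mul, Real.zero_rpow (by linarith)]
      · nth_rewrite 1 [← Real.rpow_one x]
        rw [← Real.rpow_add h0]; congr 1; ring
    have hc : p.HolderConjugate (p/(p-1)) := Real.HolderConjugate.conjExponent hp
    have y := Real.young_inequality_of_nonneg hx (Real.rpow_nonneg hm (p-1)) hc
    rw [← Real.rpow_mul hm, show (p-1) * (p/(p-1)) = p by field_simp] at y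
    rw [mul_assoc, e, mul_assoc]
    have : p/(p-1) * (x * m ^ (p-1)) ≤ p/(p-1) * (x ^ p / p + m ^ p / (p / (p-1))) := by gcongr
    have e3 : p/(p-1) * (x ^ p / p + m ^ p / (p / (p-1))) = x^p/(p-1) + m^p := by field_simp
    have e4 : p/(p-1) * x^p = x^p + x^p/(p-1) := by field_simp; ring
    linarith

/-- Strong convexity for `1 < p ≤ 2`. -/
theorem jg_taylor (p : ℝ) (hp : 1 < p) (hp2 : p ≤ 2) (x r : ℝ) (hx : 0 ≤ x) (hr : 0 ≤ r)
    (M : ℝ) (hM : 0 < M) (hxM : x ≤ M) (hrM : r ≤ M) :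
    r ^ p + p * r ^ (p-1) * (x - r) + p*(p-1)/2 * M ^ (p-2) * (x-r)^2 ≤ x ^ p := by
  set c := p*(p-1)/2 * M ^ (p-2) with hc
  -- g(u) = p u^(p-1) - 2 c u is monotone on [0,M]
  have hg : ∀ u ∈ Set.Icc 0 M, ∀ v ∈ Set.Icc 0 M, u ≤ v →
      p * u ^ (p-1) - 2 * c * u ≤ p * v ^ (p-1) - 2 * c * v := by
    have : MonotoneOn (fun u : ℝ => p * u ^ (p-1) - 2 * c * u) (Set.Icc 0 M) := by
      apply monotoneOn_of_deriv_nonneg (convex_Icc 0 M)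
      · apply ContinuousOn.sub
        · apply ContinuousOn.mul continuousOn_const
          exact (Real.continuous_rpow_const (by linarith)).continuousOn
        · fun_prop
      · intro u hu
        rw [interior_Icc] at hu
        have := Real.hasDerivAt_rpow_const (x := u) (p := p-1) (Or.inl hu.1.ne')
        exact ((this.const_mul p).sub ((hasDerivAt_id u).const_mul (2*c))).differentiableAt.differentiableWithinAt
      · intro u hu
        rw [interior_Icc] at hu
        have := Real.hasDerivAt_rpow_const (x := u) (p := p-1) (Or.inl hu.1.ne')
        have h2 := (this.const_mul p).sub ((hasDerivAt_id u).const_mul (2*c))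
        have h3 : deriv (fun u : ℝ => p * u ^ (p-1) - 2 * c * u) u = _ := h2.deriv
        rw [h3, hc]
        have h4 : M ^ (p-2) ≤ u ^ (p-2) :=
          Real.rpow_le_rpow_of_nonpos hu.1 hu.2.le (by linarith)
        have e : p - 1 - 1 = p - 2 := by ring
        rw [e]
        have : 0 ≤ p * (p-1) * (u ^ (p-2) - M ^ (p-2)) := by
          apply mul_nonneg
          · nlinarith
          · linarith
        simp only [mul_one]
        linarith
    intro u hu v hv huv
    exact this hu hv huv
  -- f(u) = u^p - c u^2 - tangent
  have hd : ∀ u : ℝ, HasDerivAt (fun u : ℝ => u ^ p - (r ^ p + p * r ^ (p-1) * (u - r) + c * (u-r)^2))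
      (p * u ^ (p-1) - (p * r ^ (p-1) + c * (2 * (u - r)))) u := by
    intro u
    have a := Real.hasDerivAt_rpow_const (x := u) (p := p) (Or.inr hp.le)
    have b : HasDerivAt (fun u : ℝ => r ^ p + p * r ^ (p-1) * (u - r) + c * (u-r)^2)
       (p * r ^ (p-1) + c * (2 * (u - r))) u := by
      have := ((((hasDerivAt_id u).sub_const r).const_mul (p * r ^ (p-1))).const_add (r ^ p)).add
        ((((hasDerivAt_id u).sub_const r).pow 2).const_mul c)
      exact this.congr_deriv (by simp)
    exact a.sub b
  have hcont : Continuous (fun u : ℝ => u ^ p - (r ^ p + p * r ^ (p-1) * (u - r) + c * (u-r)^2)) :=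
    continuous_iff_continuousAt.2 fun u => (hd u).continuousAt
  have key : 0 ≤ x ^ p - (r ^ p + p * r ^ (p-1) * (x - r) + c * (x-r)^2) := by
    rcases le_total r x with h | h
    · have : MonotoneOn (fun u : ℝ => u ^ p - (r ^ p + p * r ^ (p-1) * (u - r) + c * (u-r)^2)) (Set.Icc r M) := by
        apply monotoneOn_of_deriv_nonneg (convex_Icc r M) hcont.continuousOn
          (fun u _ => (hd u).differentiableAt.differentiableWithinAt)
        intro u hu
        rw [interior_Icc] at hu
        rw [(hd u).deriv]
        have := hg r ⟨hr, hrM⟩ u ⟨hr.trans hu.1.le, hu.2.le⟩ hu.1.le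
        linarith
      have := this ⟨le_rfl, hrM⟩ ⟨h, hxM⟩ h
      simpa using this
    · have : AntitoneOn (fun u : ℝ => u ^ p - (r ^ p + p * r ^ (p-1) * (u - r) + c * (u-r)^2)) (Set.Icc 0 r) := by
        apply antitoneOn_of_deriv_nonpos (convex_Icc 0 r) hcont.continuousOn
          (fun u _ => (hd u).differentiableAt.differentiableWithinAt)
        intro u hu
        rw [interior_Icc] at hu
        rw [(hd u).deriv]
        have := hg u ⟨hu.1.le, hu.2.le.trans hrM⟩ r ⟨hr, hrM⟩ hu.2.le
        linarith
      have := this ⟨hx, h⟩ ⟨hr, le_rfl⟩ h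
      simpa using this
  linarith

end JGBellman

section JGJump
variable {V : Type*} [AddCommGroup V]

theorem jg_mono_bellman (B G : ℝ → ℝ × ℕ × ℝ → ℝ) (α p c C : ℝ) (hc : 0 < c)
    (h1 : ∀ s x, jgInv s → 0 ≤ x → 1 ≤ |x - s.1| → B x (x, s.2.1 + 1, max s.2.2 x) ≤ B x s)
    (h2 : ∀ s x y, B ((x+y)/2) s = (B x s + B y s)/2)
    (h3 : ∀ s x, jgInv s → 0 ≤ x → G x s ≤ B x s)
    (h4 : ∀ s x, jgInv s → 0 ≤ x → c * (s.2.1 : ℝ) ^ α - C * x ^ p ≤ G x s)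
    (h5 : ∀ x, 0 ≤ x → B x (x, 0, x) ≤ 0)
    (h : ℕ → V) (F : V → ℝ) (hF : ∀ y, 0 ≤ F y) (n : ℕ) (y : V) :
    ∑ A ∈ (Finset.range n).powerset,
      (jgK (fun i => jgM h F i (y - jgS h A n + jgS h A i)) n : ℝ) ^ α
      ≤ (C / c) * ∑ A ∈ (Finset.range n).powerset, F (y - jgS h A n) ^ p := by
  have hn := jgM_nonneg h F hF n y
  have key := jg_bellman jgUpd jgInv B (fun x s => c * (s.2.1 : ℝ) ^ α - C * x ^ p)
    (fun s x hs hx => ⟨jgInv_upd s x hs hx, by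
      unfold jgUpd
      split_ifs with hh
      · exact h1 s x hs hx hh
      · exact le_rfl⟩) h2 (fun s x hs hx => (h4 s x hs hx).trans (h3 s x hs hx)) h F hF n y
    (jgM h F n y, 0, jgM h F n y) ⟨hn, le_rfl, by simp⟩
  have k2 := h5 _ hn
  have k3 : (2:ℝ)^n * B (jgM h F n y) (jgM h F n y, 0, jgM h F n y) ≤ 0 :=
    mul_nonpos_of_nonneg_of_nonpos (by positivity) k2
  have k4 := key.trans k3
  rw [Finset.sum_sub_distrib, ← Finset.mul_sum, ← Finset.mul_sum] at k4
  have k5 : ∀ A : Finset ℕ, jgK (fun i => jgM h F i (y - jgS h A n + jgS h A i)) n =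
    (jgRun jgUpd (fun i => jgM h F i (y - jgS h A n + jgS h A i)) n
      (jgM h F n y, 0, jgM h F n y)).2.1 := by
    intro A
    unfold jgK
    simp
  simp only [k5]
  rw [div_mul_eq_mul_div, le_div_iff₀ hc]
  linarith

theorem jg_jump_le_two (p : ℝ) (hp : 1 < p) (hp2 : p ≤ 2) : ∃ C : ℝ, 0 ≤ C ∧
    ∀ (V : Type) [AddCommGroup V] (h : ℕ → V) (F : V → ℝ) (_ : ∀ y, 0 ≤ F y) (n : ℕ) (y : V),
    ∑ A ∈ (Finset.range n).powerset,
      (jgK (fun i => jgM h F i (y - jgS h A n + jgS h A i)) n : ℝ) ^ (p/2)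
      ≤ C * ∑ A ∈ (Finset.range n).powerset, F (y - jgS h A n) ^ p := by
  have hp1 : 0 < p - 1 := by linarith
  set c := p*(p-1)/2 with hc
  have hc0 : 0 < c := by positivity
  set ε := (p-1)/(2*p) with hε
  have hε0 : 0 < ε := by positivity
  set c' := min c (1/2) with hc'
  have hc'0 : 0 < c' := by positivity
  refine ⟨(1 + p/(p-1) * ε ^ (1-p)) / c', by positivity, ?_⟩
  intro V _
  apply jg_mono_bellman
    (fun x s => c * s.2.1 * s.2.2 ^ (p-2) - (s.1 ^ p + p * s.1 ^ (p-1) * (x - s.1))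
      + (s.2.2 ^ p - p/(p-1) * x * s.2.2 ^ (p-1)))
    (fun x s => c * s.2.1 * s.2.2 ^ (p-2) - x ^ p
      + (s.2.2 ^ p - p/(p-1) * x * s.2.2 ^ (p-1))) (p/2) p c' _ hc'0
  · rintro ⟨r, k, m⟩ x ⟨i1, i2, i3⟩ hx hxr
    simp only at *
    have hm' : 1 ≤ max m x := by
      rcases le_abs.1 hxr with h | h
      · exact le_max_of_le_right (by linarith)
      · exact le_max_of_le_left (by linarith)
    have d := jg_doob p hp x m hx (i1.trans i2)
    have t := jg_taylor p hp hp2 x r hx i1 (max m x) (by linarith) (le_max_right _ _)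
      (i2.trans (le_max_left _ _))
    have sq : 1 ≤ (x - r)^2 := by
      rw [← sq_abs]; nlinarith
    have e1 : c * (max m x) ^ (p-2) ≤ c * (max m x) ^ (p-2) * (x-r)^2 :=
      le_mul_of_one_le_right (by positivity) sq
    have e2 : c * k * (max m x) ^ (p-2) ≤ c * k * m ^ (p-2) := by
      rcases Nat.eq_zero_or_pos k with hk | hk
      · simp [hk]
      · have := i3 (by omega)
        exact mul_le_mul_of_nonneg_left
          (Real.rpow_le_rpow_of_nonpos (by linarith) (le_max_left _ _) (by linarith))
          (by positivity)
    push_cast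
    simp only [sub_self, mul_zero, add_zero]
    rw [← hc] at t
    have e3 : c * ((k:ℝ)+1) * (max m x)^(p-2) = c * k * (max m x)^(p-2) + c * (max m x)^(p-2) := by ring
    linarith
  · intro s x y; ring
  · rintro ⟨r, k, m⟩ x ⟨i1, i2, i3⟩ hx
    simp only at *
    have t := jg_taylor p hp hp2 x r hx i1 (max (max x r) 1) (by positivity) (by simp) (by simp)
    have : 0 ≤ p*(p-1)/2 * (max (max x r) 1) ^ (p-2) * (x-r)^2 := by positivity
    linarith
  · rintro ⟨r, k, m⟩ x ⟨i1, i2, i3⟩ hx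
    simp only at *
    have hm : 0 ≤ m := i1.trans i2
    have y := jg_young p hp.le ε hε0 x m hx hm
    have y2 : p/(p-1) * (x * m ^ (p-1)) ≤ p/(p-1) * (ε * m ^ p + ε ^ (1-p) * x ^ p) := by gcongr
    have y3 : p/(p-1) * (ε * m ^ p + ε ^ (1-p) * x ^ p) = m^p/2 + p/(p-1) * ε ^ (1-p) * x^p := by
      rw [mul_add, ← mul_assoc, hε]
      congr 1
      · field_simp
      · ring
    have k1 : c' * (k:ℝ) ^ (p/2) ≤ c * k * m ^ (p-2) + 1/2 * m ^ p := by
      rcases Nat.eq_zero_or_pos k with hk | hk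
      · rw [hk]; simp only [Nat.cast_zero]
        rw [Real.zero_rpow (by linarith)]
        simp; positivity
      · have hm1 := i3 (by omega)
        have hk0 : (0:ℝ) < k := by exact_mod_cast hk
        rcases le_total (k:ℝ) (m^2) with hkm | hkm
        · have : (k:ℝ) ^ (p/2) ≤ m ^ p := by
            calc (k:ℝ) ^ (p/2) ≤ (m^2) ^ (p/2) := by gcongr
              _ = m ^ p := by
                rw [← Real.rpow_natCast, ← Real.rpow_mul hm]; congr 1; push_cast; ring
          have h2 : c' * (k:ℝ) ^ (p/2) ≤ 1/2 * m ^ p :=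
            mul_le_mul (min_le_right _ _) this (by positivity) (by positivity)
          have : 0 ≤ c * k * m ^ (p-2) := by positivity
          linarith
        · have : (k:ℝ) ^ (p/2) ≤ k * m ^ (p-2) := by
            have e : (k:ℝ) ^ (p/2) = k * (k:ℝ) ^ ((p-2)/2) := by
              nth_rewrite 2 [← Real.rpow_one (k:ℝ)]
              rw [← Real.rpow_add hk0]; congr 1; ring
            rw [e]
            gcongr
            calc (k:ℝ) ^ ((p-2)/2) ≤ (m^2) ^ ((p-2)/2) :=
                  Real.rpow_le_rpow_of_nonpos (by positivity) hkm (by linarith)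
              _ = m ^ (p-2) := by
                rw [← Real.rpow_natCast, ← Real.rpow_mul hm]; congr 1; push_cast; ring
          have h2 : c' * (k:ℝ) ^ (p/2) ≤ c * (k * m ^ (p-2)) :=
            mul_le_mul (min_le_left _ _) this (by positivity) (by positivity)
          have : 0 ≤ m ^ p := by positivity
          linarith
    linarith
  · intro x hx
    have e : x * x ^ (p-1) = x ^ p := by
      rcases hx.eq_or_lt with rfl | h0
      · rw [zero_mul, Real.zero_rpow (by linarith)]
      · nth_rewrite 1 [← Real.rpow_one x]
        rw [← Real.rpow_add h0]; congr 1; ring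
    simp only [Nat.cast_zero, mul_zero, zero_mul, sub_self, add_zero]
    rw [mul_assoc, e]
    have : 0 ≤ p/(p-1) * x^p := by positivity
    linarith

theorem jg_jump_ge_two (p : ℝ) (hp2 : 2 ≤ p) : ∃ C : ℝ, 0 ≤ C ∧
    ∀ (V : Type) [AddCommGroup V] (h : ℕ → V) (F : V → ℝ) (_ : ∀ y, 0 ≤ F y) (n : ℕ) (y : V),
    ∑ A ∈ (Finset.range n).powerset,
      (jgK (fun i => jgM h F i (y - jgS h A n + jgS h A i)) n : ℝ) ^ (p/2)
      ≤ C * ∑ A ∈ (Finset.range n).powerset, F (y - jgS h A n) ^ p := by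
  have hp1 : 0 < p - 1 := by linarith
  have hp : 1 < p := by linarith
  set s := p/2 with hs
  have hs1 : 1 ≤ s := by rw [hs]; linarith
  have hs0 : 0 < s := by linarith
  have hps : p = 2 * s := by rw [hs]; ring
  set ε := (p-1)/(2*p) with hε
  have hε0 : 0 < ε := by positivity
  set δ := (2:ℝ)^(-s)/(2*s) with hδ
  have hδ0 : 0 < δ := by positivity
  refine ⟨(δ^(1-s) + 2/s * (p/(p-1) * ε ^ (1-p))) / δ, by positivity, ?_⟩
  intro V _
  apply jg_mono_bellman
    (fun x S => ((S.2.1 - 1 : ℕ):ℝ)^s/s - (S.2.1:ℝ)^(s-1) * (S.1 ^ 2 + 2 * S.1 * (x - S.1))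
      + 2/s * (S.2.2 ^ p - p/(p-1) * x * S.2.2 ^ (p-1)))
    (fun x S => ((S.2.1 - 1 : ℕ):ℝ)^s/s - (S.2.1:ℝ)^(s-1) * x ^ 2
      + 2/s * (S.2.2 ^ p - p/(p-1) * x * S.2.2 ^ (p-1))) s p δ _ hδ0
  · rintro ⟨r, k, m⟩ x ⟨i1, i2, i3⟩ hx hxr
    simp only at *
    have d := mul_le_mul_of_nonneg_left (jg_doob p hp x m hx (i1.trans i2))
      (show 0 ≤ 2/s by positivity)
    have sq : 1 ≤ (x - r)^2 := by
      rw [← sq_abs]; nlinarith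
    have w1 : (k:ℝ)^(s-1) ≤ ((k:ℝ)+1)^(s-1) := by
      apply Real.rpow_le_rpow (by positivity) (by linarith) (by linarith)
    have w2 : (k:ℝ)^s/s ≤ ((k-1:ℕ):ℝ)^s/s + (k:ℝ)^(s-1) := by
      rcases Nat.eq_zero_or_pos k with hk | hk
      · subst hk
        simp only [Nat.cast_zero, zero_tsub]
        have : (0:ℝ) ≤ 0^(s-1) := by positivity
        linarith
      · have hk0 : (0:ℝ) < k := by exact_mod_cast hk
        have b := one_add_mul_self_le_rpow_one_add (s := -1/(k:ℝ)) (by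
          rw [le_div_iff₀ hk0]
          have : (1:ℝ) ≤ k := by exact_mod_cast hk
          linarith) hs1
        have e : 1 + -1/(k:ℝ) = ((k-1:ℕ):ℝ)/k := by
          rw [Nat.cast_sub hk]; field_simp; push_cast; ring
        rw [e, Real.div_rpow (by positivity) (by positivity), le_div_iff₀ (by positivity)] at b
        have e2 : (k:ℝ)^s = k * (k:ℝ)^(s-1) := by
          nth_rewrite 2 [← Real.rpow_one (k:ℝ)]
          rw [← Real.rpow_add hk0]; congr 1; ring
        have b2 : (1 + s * (-1/(k:ℝ))) * (k:ℝ)^s = (k:ℝ)^s - s * (k:ℝ)^(s-1) := by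
          rw [e2]; field_simp; ring
        rw [b2] at b
        rw [div_add' _ _ _ hs0.ne']
        gcongr
        linarith
    have w3 : 0 ≤ (k:ℝ)^(s-1) * ((x-r)^2 - 1) := mul_nonneg (by positivity) (by linarith)
    have w4 : 0 ≤ (((k:ℝ)+1)^(s-1) - (k:ℝ)^(s-1)) * x^2 := mul_nonneg (by linarith) (by positivity)
    push_cast
    simp only [sub_self, mul_zero, add_zero, Nat.add_sub_cancel]
    nlinarith
  · intro s x y; ring
  · rintro ⟨r, k, m⟩ x ⟨i1, i2, i3⟩ hx
    simp only at *
    have w3 : 0 ≤ (k:ℝ)^(s-1) * ((x-r)^2) := by positivity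
    nlinarith
  · rintro ⟨r, k, m⟩ x ⟨i1, i2, i3⟩ hx
    simp only at *
    have hm : 0 ≤ m := i1.trans i2
    have y := jg_young p hp.le ε hε0 x m hx hm
    have y2 : p/(p-1) * (x * m ^ (p-1)) ≤ p/(p-1) * (ε * m ^ p + ε ^ (1-p) * x ^ p) := by gcongr
    have y3 : p/(p-1) * (ε * m ^ p + ε ^ (1-p) * x ^ p) = m^p/2 + p/(p-1) * ε ^ (1-p) * x^p := by
      rw [mul_add, ← mul_assoc, hε]
      congr 1
      · field_simp
      · ring
    have y4 : m^p/2 - p/(p-1) * ε ^ (1-p) * x^p ≤ m^p - p/(p-1) * x * m^(p-1) := by linarith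
    have y5 := mul_le_mul_of_nonneg_left y4 (show 0 ≤ 2/s by positivity)
    have u := jg_young s hs1 δ hδ0 (x^2) k (by positivity) (by positivity)
    have u2 : (x^2)^s = x^p := by
      rw [← Real.rpow_natCast, ← Real.rpow_mul hx]; congr 1; push_cast; linarith
    rw [u2] at u
    have k1 : 2 * δ * (k:ℝ)^s ≤ ((k-1:ℕ):ℝ)^s/s + 1/s * m^p := by
      have e : 2 * δ = (2:ℝ)^(-s)/s := by rw [hδ]; field_simp
      rw [e]
      have : (2:ℝ)^(-s) * (k:ℝ)^s ≤ ((k-1:ℕ):ℝ)^s + m^p := by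
        rcases Nat.eq_zero_or_pos k with hk | hk
        · rw [hk]; simp only [Nat.cast_zero]
          rw [Real.zero_rpow (by linarith)]
          simp; positivity
        · have hm1 := i3 (by omega)
          have hmp : 1 ≤ m^p := Real.one_le_rpow hm1 (by linarith)
          have e : (2:ℝ)^(-s) * (k:ℝ)^s = ((k:ℝ)/2)^s := by
            rw [Real.div_rpow (by positivity) (by norm_num), Real.rpow_neg (by norm_num)]
            field_simp
          rw [e]
          rcases Nat.lt_or_ge k 2 with h2 | h2
          · have : k = 1 := by omega
            subst this
            have : ((1:ℕ):ℝ)/2 ≤ 1 := by norm_num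
            have := Real.rpow_le_one (x := ((1:ℕ):ℝ)/2) (by positivity) this hs0.le
            have h0 : (0:ℝ) ≤ ((1-1:ℕ):ℝ)^s := by positivity
            exact this.trans (hmp.trans (le_add_of_nonneg_left h0))
          · have : (k:ℝ)/2 ≤ ((k-1:ℕ):ℝ) := by
              rw [Nat.cast_sub hk]
              have : (2:ℝ) ≤ k := by exact_mod_cast h2
              push_cast; linarith
            have := Real.rpow_le_rpow (by positivity) this hs0.le
            linarith
      calc (2:ℝ)^(-s)/s * (k:ℝ)^s = ((2:ℝ)^(-s) * (k:ℝ)^s)/s := by ring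
        _ ≤ (((k-1:ℕ):ℝ)^s + m^p)/s := by gcongr
        _ = _ := by ring
    have e6 : 2/s * (m^p/2 - p/(p-1) * ε ^ (1-p) * x^p)
      = 1/s*m^p - 2/s * (p/(p-1) * ε ^ (1-p)) * x^p := by ring
    linarith
  · intro x hx
    have e : x * x ^ (p-1) = x ^ p := by
      rcases hx.eq_or_lt with rfl | h0
      · rw [zero_mul, Real.zero_rpow (by linarith)]
      · nth_rewrite 1 [← Real.rpow_one x]
        rw [← Real.rpow_add h0]; congr 1; ring
    simp only [Nat.cast_zero, zero_tsub, sub_self, mul_zero, add_zero]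
    rw [mul_assoc, e, Real.zero_rpow hs0.ne']
    have h1 : 0 ≤ x^p := by positivity
    have h2 : 1 ≤ p/(p-1) := by rw [le_div_iff₀ hp1]; linarith
    have h3 : x^p - p/(p-1) * x^p ≤ 0 := by nlinarith
    have h4 : 2/s * (x^p - p/(p-1) * x^p) ≤ 0 :=
      mul_nonpos_of_nonneg_of_nonpos (by positivity) h3
    have h5 : (0:ℝ) ≤ 0^(s-1) * x^2 := by positivity
    rw [zero_div]
    linarith

theorem jg_jump (p : ℝ) (hp : 1 < p) : ∃ C : ℝ, 0 ≤ C ∧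
    ∀ (V : Type) [AddCommGroup V] (h : ℕ → V) (F : V → ℝ) (_ : ∀ y, 0 ≤ F y) (n : ℕ) (y : V),
    ∑ A ∈ (Finset.range n).powerset,
      (jgK (fun i => jgM h F i (y - jgS h A n + jgS h A i)) n : ℝ) ^ (p/2)
      ≤ C * ∑ A ∈ (Finset.range n).powerset, F (y - jgS h A n) ^ p := by
  rcases le_total p 2 with h | h
  · exact jg_jump_le_two p hp h
  · exact jg_jump_ge_two p h
end JGJump

section JGCount

/-- state after reading levels `n, n-1, …, n-k`. -/
noncomputable def jgD (z : ℕ → ℝ) (n : ℕ) : ℕ → ℝ × ℕ × ℝ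
  | 0 => (z n, 0, z n)
  | (k+1) => jgUpd (jgD z n k) (z (n - (k+1)))

theorem jgRun_eq_D (z : ℕ → ℝ) (n k : ℕ) (hk : k ≤ n) :
    jgRun jgUpd z n (z n, 0, z n) = jgRun jgUpd z (n-k) (jgD z n k) := by
  induction k with
  | zero => rfl
  | succ k ih =>
    rw [ih (by omega)]
    obtain ⟨m, hm⟩ : ∃ m, n - k = m + 1 := ⟨n-k-1, by omega⟩
    have e : n - (k+1) = m := by omega
    rw [hm, e]
    simp only [jgRun, jgD]
    rw [e]

theorem jgD_near (z : ℕ → ℝ) (n k : ℕ) : |z (n-k) - (jgD z n k).1| < 1 := by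
  cases k with
  | zero => simp [jgD]
  | succ k =>
    simp only [jgD]
    unfold jgUpd
    split_ifs with h
    · simp
    · exact not_le.1 h

theorem jgD_mono (z : ℕ → ℝ) (n k j : ℕ) :
    (jgD z n k).2.1 ≤ (jgD z n (k+j)).2.1 ∧
    ((jgD z n k).2.1 = (jgD z n (k+j)).2.1 → (jgD z n k).1 = (jgD z n (k+j)).1) := by
  induction j with
  | zero => simp
  | succ j ih =>
    rw [← add_assoc]
    simp only [jgD]
    unfold jgUpd
    split_ifs with h
    · refine ⟨?_, fun h => ?_⟩
      · simp only; omega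
      · simp only at h; omega
    · exact ih

theorem jg_count (z : ℕ → ℝ) (n : ℕ) (v : ℕ → ℕ) (hv : Monotone v) (hn : ∀ i, v i ≤ n)
    (S : Finset ℕ) (hS : ∀ i ∈ S, 2 ≤ |z (v (i+1)) - z (v i)|) : S.card ≤ jgK z n := by
  set c : ℕ → ℕ := fun i => (jgD z n (n - v i)).2.1 with hc
  have c1 : ∀ i, c (i+1) ≤ c i := by
    intro i
    obtain ⟨j, hj⟩ : ∃ j, n - v i = (n - v (i+1)) + j :=
      ⟨(n - v i) - (n - v (i+1)), by have := hv (i.le_add_right 1); have := hn (i+1); omega⟩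
    simp only [hc]; rw [hj]
    exact (jgD_mono z n _ j).1
  have c2 : ∀ i ∈ S, c (i+1) < c i := by
    intro i hi
    refine lt_of_le_of_ne (c1 i) fun h => ?_
    obtain ⟨j, hj⟩ : ∃ j, n - v i = (n - v (i+1)) + j :=
      ⟨(n - v i) - (n - v (i+1)), by have := hv (i.le_add_right 1); have := hn (i+1); omega⟩
    simp only [hc] at h; rw [hj] at h
    have e := (jgD_mono z n _ j).2 h
    have a := jgD_near z n (n - v (i+1))
    have b := jgD_near z n (n - v i)
    rw [hj, ← e, ← hj] at b
    rw [Nat.sub_sub_self (hn _)] at a b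
    have := hS i hi
    rw [abs_lt] at a b
    rcases le_abs.1 this with h | h <;> linarith
  have c3 : ∀ N, (S.filter (· < N)).card + c N ≤ c 0 := by
    intro N
    induction N with
    | zero => simp
    | succ N ih =>
      by_cases hN : N ∈ S
      · have := c2 N hN
        have e : S.filter (· < N+1) = insert N (S.filter (· < N)) := by
          ext i; simp only [Finset.mem_filter, Finset.mem_insert]
          constructor
          · rintro ⟨a, b⟩
            rcases eq_or_ne i N with h | h
            · exact Or.inl h
            · exact Or.inr ⟨a, by omega⟩
          · rintro (rfl | ⟨a, b⟩)
            · exact ⟨hN, by omega⟩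
            · exact ⟨a, by omega⟩
        rw [e, Finset.card_insert_of_notMem (by simp)]
        omega
      · have := c1 N
        have e : S.filter (· < N+1) = S.filter (· < N) := by
          ext i; simp only [Finset.mem_filter]
          constructor
          · rintro ⟨a, b⟩
            have : i ≠ N := by rintro rfl; exact hN a
            exact ⟨a, by omega⟩
          · rintro ⟨a, b⟩
            exact ⟨a, by omega⟩
        rw [e]; omega
  have c4 : S.filter (· < S.sup id + 1) = S := by
    apply Finset.filter_true_of_mem
    intro i hi
    have : i ≤ S.sup id := Finset.le_sup (f := id) hi
    omega
  have c5 := c3 (S.sup id + 1)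
  rw [c4] at c5
  have c6 : c 0 ≤ jgK z n := by
    unfold jgK
    rw [jgRun_eq_D z n n le_rfl]
    simp only [Nat.sub_self, jgRun, hc]
    have := (jgD_mono z n (n - v 0) (n - (n - v 0))).1
    rwa [Nat.add_sub_cancel' (Nat.sub_le _ _)] at this
  omega

theorem jg_layer (δ lam : ℝ) (hl : 0 < lam) (L : ℕ) (h : δ < 2^(L+1) * lam) :
    δ ≤ 2 * lam + ∑ l ∈ Finset.range L, 2^(l+2) * lam * (if 2^(l+1) * lam ≤ δ then 1 else 0) := by
  induction L with
  | zero => simp at *; linarith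
  | succ L ih =>
    rw [Finset.sum_range_succ]
    rcases lt_or_ge δ (2^(L+1)*lam) with h' | h'
    · have := ih h'
      rw [if_neg (not_le.2 h')]
      linarith
    · rw [if_pos h']
      have : 0 ≤ ∑ l ∈ Finset.range L, 2^(l+2) * lam * (if 2^(l+1) * lam ≤ δ then (1:ℝ) else 0) :=
        Finset.sum_nonneg fun l _ => by split_ifs <;> positivity
      have h2 : δ < 2^(L+2) * lam := h
      linarith

theorem jg_pigeon (β : ℝ) (hβ : 1 < β) : ∃ c : ℝ, 0 < c ∧
    ∀ (ι : Type) (O : Finset ι) (w : ι → ℝ) (y : ι → ℕ → ℝ) (S : Finset ℕ) (lam : ℝ),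
    S.Nonempty → 0 < lam → (∀ o ∈ O, 0 ≤ w o) → ∑ o ∈ O, w o = 1 →
    (∀ i ∈ S, 4 * lam ≤ |∑ o ∈ O, w o * (y o (i+1) - y o i)|) →
    ∃ l : ℕ, c * (2:ℝ)^(-(β * l)) * S.card ≤
      ∑ o ∈ O, w o * ((S.filter fun i => 2^(l+1) * lam ≤ |y o (i+1) - y o i|).card : ℝ) := by
  set r : ℝ := 2^(1-β) with hr
  have r0 : 0 < r := by positivity
  have r1 : r < 1 := Real.rpow_lt_one_of_one_lt_of_neg (by norm_num) (by linarith)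
  refine ⟨(1-r)/4, by linarith, ?_⟩
  intro ι O w y S lam hne hl hw hw1 hj
  by_contra hcon
  push Not at hcon
  obtain ⟨L, hL⟩ : ∃ L : ℕ, ∀ o ∈ O, ∀ i ∈ S, |y o (i+1) - y o i| < 2^(L+1) * lam := by
    obtain ⟨B, hB⟩ : ∃ B : ℝ, ∀ o ∈ O, ∀ i ∈ S, |y o (i+1) - y o i| ≤ B := by
      refine ⟨∑ o ∈ O, ∑ i ∈ S, |y o (i+1) - y o i|, fun o ho i hi => ?_⟩
      calc _ ≤ ∑ i ∈ S, |y o (i+1) - y o i| :=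
            Finset.single_le_sum (f := fun i => |y o (i+1) - y o i|) (fun _ _ => abs_nonneg _) hi
        _ ≤ _ := Finset.single_le_sum (f := fun o => ∑ i ∈ S, |y o (i+1) - y o i|)
            (fun _ _ => Finset.sum_nonneg fun _ _ => abs_nonneg _) ho
    obtain ⟨L, hL⟩ := pow_unbounded_of_one_lt (B / lam) (one_lt_two : (1:ℝ) < 2)
    refine ⟨L, fun o ho i hi => (hB o ho i hi).trans_lt ?_⟩
    rw [div_lt_iff₀ hl] at hL
    have : (2:ℝ)^L * lam ≤ 2^(L+1) * lam := by
      gcongr <;> norm_num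
    linarith
  have s1 : ∀ i ∈ S, (1:ℝ) ≤ ∑ l ∈ Finset.range L, 2^(l+1) * ∑ o ∈ O, w o *
      (if 2^(l+1) * lam ≤ |y o (i+1) - y o i| then 1 else 0) := by
    intro i hi
    have a1 : 4 * lam ≤ ∑ o ∈ O, w o * |y o (i+1) - y o i| := by
      refine (hj i hi).trans ((Finset.abs_sum_le_sum_abs _ _).trans (le_of_eq ?_))
      apply Finset.sum_congr rfl
      intro o ho
      rw [abs_mul, abs_of_nonneg (hw o ho)]
    have a2 : ∑ o ∈ O, w o * |y o (i+1) - y o i| ≤ ∑ o ∈ O, w o * (2 * lam +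
        ∑ l ∈ Finset.range L, 2^(l+2) * lam *
          (if 2^(l+1) * lam ≤ |y o (i+1) - y o i| then 1 else 0)) :=
      Finset.sum_le_sum fun o ho => mul_le_mul_of_nonneg_left
        (jg_layer _ lam hl L (hL o ho i hi)) (hw o ho)
    have a3 : ∑ o ∈ O, w o * (2 * lam +
        ∑ l ∈ Finset.range L, 2^(l+2) * lam *
          (if 2^(l+1) * lam ≤ |y o (i+1) - y o i| then 1 else 0)) =
        2 * lam + 2 * lam * ∑ l ∈ Finset.range L, 2^(l+1) * ∑ o ∈ O, w o *
      (if 2^(l+1) * lam ≤ |y o (i+1) - y o i| then (1:ℝ) else 0) := by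
      simp only [mul_add, Finset.sum_add_distrib]
      rw [← Finset.sum_mul, hw1, one_mul]
      congr 1
      simp only [Finset.mul_sum]
      rw [Finset.sum_comm]
      refine Finset.sum_congr rfl fun l _ => Finset.sum_congr rfl fun o _ => ?_
      ring
    rw [a3] at a2
    have : 2 * lam * 1 ≤ 2 * lam * ∑ l ∈ Finset.range L, 2^(l+1) * ∑ o ∈ O, w o *
      (if 2^(l+1) * lam ≤ |y o (i+1) - y o i| then (1:ℝ) else 0) := by linarith
    exact le_of_mul_le_mul_left this (by positivity)
  have s2 : (S.card : ℝ) ≤ ∑ l ∈ Finset.range L, 2^(l+1) * ∑ o ∈ O, w o *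
      ((S.filter fun i => 2^(l+1) * lam ≤ |y o (i+1) - y o i|).card : ℝ) := by
    have := Finset.sum_le_sum s1
    rw [Finset.sum_const, nsmul_eq_mul, mul_one, Finset.sum_comm] at this
    refine this.trans (le_of_eq ?_)
    refine Finset.sum_congr rfl fun l _ => ?_
    rw [← Finset.mul_sum, Finset.sum_comm]
    congr 1
    refine Finset.sum_congr rfl fun o _ => ?_
    rw [← Finset.mul_sum]
    congr 1
    simp [Finset.sum_boole]
  have s3 : ∑ l ∈ Finset.range L, 2^(l+1) * ∑ o ∈ O, w o *
      ((S.filter fun i => 2^(l+1) * lam ≤ |y o (i+1) - y o i|).card : ℝ)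
      ≤ ∑ l ∈ Finset.range L, (1-r)/2 * S.card * r^l := by
    refine Finset.sum_le_sum fun l _ => ?_
    calc _ ≤ (2:ℝ)^(l+1) * ((1-r)/4 * (2:ℝ)^(-(β * l)) * S.card) := by
          gcongr; exact (hcon l).le
      _ = (1-r)/2 * S.card * ((2:ℝ)^l * (2:ℝ)^(-(β * l))) := by ring
      _ = _ := by
        congr 1
        rw [hr, ← Real.rpow_natCast, ← Real.rpow_natCast, ← Real.rpow_add (by norm_num), ← Real.rpow_mul (by norm_num)]
        congr 1; ring
  rw [← Finset.mul_sum] at s3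
  have s4 : (1-r) * ∑ l ∈ Finset.range L, r^l ≤ 1 := by
    rw [mul_comm, geom_sum_mul_neg]
    have : 0 ≤ r^L := by positivity
    linarith
  have s5 : (0:ℝ) < S.card := by exact_mod_cast hne.card_pos
  have : (1-r)/2 * S.card * ∑ l ∈ Finset.range L, r^l = S.card / 2 * ((1-r) * ∑ l ∈ Finset.range L, r^l) := by ring
  nlinarith

theorem jg_avg (p : ℝ) (hp : 1 < p) : ∃ C γ : ℝ, 0 ≤ C ∧ γ < p ∧
    ∀ (ι : Type) (O : Finset ι) (w : ι → ℝ) (y : ι → ℕ → ℝ) (S : Finset ℕ) (lam : ℝ)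
    (K : ℕ → ι → ℕ),
    0 < lam → (∀ o ∈ O, 0 ≤ w o) → ∑ o ∈ O, w o = 1 →
    (∀ i ∈ S, 4 * lam ≤ |∑ o ∈ O, w o * (y o (i+1) - y o i)|) →
    (∀ l, ∀ o ∈ O, (S.filter fun i => 2^(l+1) * lam ≤ |y o (i+1) - y o i|).card ≤ K l o) →
    ∃ l : ℕ, (S.card : ℝ)^(p/2) ≤ C * (2:ℝ)^(γ * l) * ∑ o ∈ O, w o * (K l o : ℝ)^(p/2) := by
  set β := (1 + min 2 p)/2 with hβ
  have m1 : 1 < min 2 p := lt_min (by norm_num) hp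
  have b1 : 1 < β := by rw [hβ]; linarith
  have b2 : β < 2 := by have := min_le_left 2 p; rw [hβ]; linarith
  have b3 : β < p := by have := min_le_right 2 p; rw [hβ]; linarith
  obtain ⟨c, c0, hc⟩ := jg_pigeon β b1
  have hα : 0 < p/2 := by linarith
  rcases le_total (p/2) 1 with ha | ha
  · refine ⟨c⁻¹, β, by positivity, b3, ?_⟩
    intro ι O w y S lam K hl hw hw1 hj hK
    rcases S.eq_empty_or_nonempty with rfl | hne
    · refine ⟨0, ?_⟩
      rw [Finset.card_empty, Nat.cast_zero, Real.zero_rpow hα.ne']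
      have : 0 ≤ ∑ o ∈ O, w o * (K 0 o : ℝ)^(p/2) :=
        Finset.sum_nonneg fun o ho => mul_nonneg (hw o ho) (by positivity)
      positivity
    obtain ⟨l, h⟩ := hc ι O w y S lam hne hl hw hw1 hj
    refine ⟨l, ?_⟩
    have s5 : (0:ℝ) < S.card := by exact_mod_cast hne.card_pos
    have h2 : ∑ o ∈ O, w o * ((S.filter fun i => 2^(l+1) * lam ≤ |y o (i+1) - y o i|).card : ℝ)
        ≤ (S.card:ℝ)^(1-p/2) * ∑ o ∈ O, w o * (K l o : ℝ)^(p/2) := by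
      rw [Finset.mul_sum]
      refine Finset.sum_le_sum fun o ho => ?_
      set n := (S.filter fun i => 2^(l+1) * lam ≤ |y o (i+1) - y o i|).card
      have hn : n ≤ S.card := Finset.card_filter_le _ _
      have : (n:ℝ) ≤ (S.card:ℝ)^(1-p/2) * (K l o : ℝ)^(p/2) := by
        rcases Nat.eq_zero_or_pos n with h0 | h0
        · rw [h0]; push_cast; positivity
        · have h0' : (0:ℝ) < n := by exact_mod_cast h0
          calc (n:ℝ) = (n:ℝ)^(1-p/2) * (n:ℝ)^(p/2) := by
                rw [← Real.rpow_add h0']; simp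
            _ ≤ _ := by
              gcongr
              exact hK l o ho
      calc _ ≤ w o * ((S.card:ℝ)^(1-p/2) * (K l o : ℝ)^(p/2)) :=
            mul_le_mul_of_nonneg_left this (hw o ho)
        _ = _ := by ring
    have h3 := h.trans h2
    have e : (S.card:ℝ) = (S.card:ℝ)^(1-p/2) * (S.card:ℝ)^(p/2) := by
      rw [← Real.rpow_add s5, sub_add_cancel, Real.rpow_one]
    have h4 : c * (2:ℝ)^(-(β * l)) * (S.card:ℝ)^(p/2) ≤ ∑ o ∈ O, w o * (K l o : ℝ)^(p/2) := by
      have : 0 < (S.card:ℝ)^(1-p/2) := Real.rpow_pos_of_pos s5 _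
      refine le_of_mul_le_mul_left ?_ this
      refine le_trans (le_of_eq ?_) h3
      nth_rewrite 3 [e]; ring
    rw [Real.rpow_neg (by norm_num)] at h4
    have h2p : (0:ℝ) < 2^(β*l) := by positivity
    calc (S.card:ℝ)^(p/2) = c⁻¹ * 2^(β*l) * (c * (2^(β * l))⁻¹ * (S.card:ℝ)^(p/2)) := by
          generalize (S.card:ℝ)^(p/2) = X
          field_simp
      _ ≤ _ := by gcongr
  · refine ⟨(c^(p/2))⁻¹, β * (p/2), by positivity, by nlinarith, ?_⟩
    intro ι O w y S lam K hl hw hw1 hj hK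
    rcases S.eq_empty_or_nonempty with rfl | hne
    · refine ⟨0, ?_⟩
      rw [Finset.card_empty, Nat.cast_zero, Real.zero_rpow hα.ne']
      have : 0 ≤ ∑ o ∈ O, w o * (K 0 o : ℝ)^(p/2) :=
        Finset.sum_nonneg fun o ho => mul_nonneg (hw o ho) (by positivity)
      positivity
    obtain ⟨l, h⟩ := hc ι O w y S lam hne hl hw hw1 hj
    refine ⟨l, ?_⟩
    have h1 : ∑ o ∈ O, w o * ((S.filter fun i => 2^(l+1) * lam ≤ |y o (i+1) - y o i|).card : ℝ)
        ≤ ∑ o ∈ O, w o * (K l o : ℝ) :=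
      Finset.sum_le_sum fun o ho => mul_le_mul_of_nonneg_left
        (by exact_mod_cast hK l o ho) (hw o ho)
    have h2 := Real.rpow_arith_mean_le_arith_mean_rpow O w (fun o => (K l o : ℝ)) hw hw1
      (fun o _ => by positivity) ha
    have h3 := (Real.rpow_le_rpow (by positivity) (h.trans h1) hα.le).trans h2
    rw [Real.mul_rpow (by positivity) (by positivity), Real.mul_rpow (by positivity) (by positivity),
      ← Real.rpow_mul (by norm_num), show -(β * l) * (p/2) = -(β * (p/2) * l) by ring,
      Real.rpow_neg (by norm_num)] at h3
    have h2p : (0:ℝ) < 2^(β * (p/2) * l) := by positivity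
    calc (S.card:ℝ)^(p/2) = (c^(p/2))⁻¹ * 2^(β * (p/2) * l) * (c^(p/2) * (2^(β * (p/2) * l))⁻¹ * (S.card:ℝ)^(p/2)) := by
          generalize (S.card:ℝ)^(p/2) = X
          field_simp
      _ ≤ _ := by gcongr
end JGCount

section JGAct
variable {V : Type} [AddCommGroup V]

/-- translations -/
noncomputable def jgT (V : Type) [AddCommGroup V] : Multiplicative V →* Module.End ℝ (V → ℝ) where
  toFun v := { toFun := fun f x => f (x - v.toAdd), map_add' := fun _ _ => rfl, map_smul' := fun _ _ => rfl }
  map_one' := by ext f x; simp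
  map_mul' a b := by
    refine LinearMap.ext fun f => funext fun x => ?_
    change f (x - (a * b).toAdd) = f (x - a.toAdd - b.toAdd)
    rw [toAdd_mul, sub_sub]

/-- action of the group algebra by convolution -/
noncomputable def jgAct (V : Type) [AddCommGroup V] :
    AddMonoidAlgebra ℝ V →ₐ[ℝ] Module.End ℝ (V → ℝ) :=
  AddMonoidAlgebra.lift ℝ _ V (jgT V)

theorem jgAct_single (v : V) (c : ℝ) (f : V → ℝ) (x : V) :
    jgAct V (AddMonoidAlgebra.single v c) f x = c * f (x - v) := by
  unfold jgAct
  rw [AddMonoidAlgebra.lift_single]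
  rfl

/-- averaging element -/
noncomputable def jgB (h : V) : AddMonoidAlgebra ℝ V :=
  (1/2 : ℝ) • (1 + AddMonoidAlgebra.single h 1)

theorem jgAct_B (h : V) (f : V → ℝ) (x : V) :
    jgAct V (jgB h) f x = (f x + f (x - h)) / 2 := by
  unfold jgB
  rw [map_smul, map_add, map_one]
  simp only [LinearMap.smul_apply, LinearMap.add_apply, Pi.smul_apply, Pi.add_apply, jgAct_single]
  simp; ring

/-- symmetric averaging element -/
noncomputable def jgKap (h : V) : AddMonoidAlgebra ℝ V := jgB h * jgB (-h)

theorem jgM_act (h : ℕ → V) (F : V → ℝ) (n : ℕ) :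
    jgM h F n = jgAct V (∏ s ∈ Finset.range n, jgB (h s)) F := by
  induction n with
  | zero => funext y; simp [jgM]
  | succ n ih =>
    funext y
    rw [Finset.prod_range_succ, mul_comm, map_mul, Module.End.mul_apply, jgAct_B, ← ih]
    rfl

theorem jg_sumA (h : ℕ → V) (n i : ℕ) (hi : i ≤ n) (G : V → ℝ) (x : V) :
    ∑ A ∈ (Finset.range n).powerset, G (x + jgS h A i)
      = 2 ^ n * jgAct V (∏ s ∈ Finset.range i, jgB (-h s)) G x := by
  induction n generalizing i G with
  | zero =>
    obtain rfl : i = 0 := by omega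
    simp [jgS]
  | succ n ih =>
    rw [Finset.range_add_one, Finset.sum_powerset_insert (by simp)]
    have e1 : ∀ A ∈ (Finset.range n).powerset, n ∉ A := by
      intro A hA hn
      have := Finset.mem_powerset.1 hA hn
      simp at this
    rcases Nat.lt_or_ge n i with h1 | h1
    · obtain rfl : i = n + 1 := by omega
      have a1 : ∑ A ∈ (Finset.range n).powerset, G (x + jgS h A (n+1)) =
          ∑ A ∈ (Finset.range n).powerset, G (x + jgS h A n) :=
        Finset.sum_congr rfl fun A hA => by rw [jgS_succ_not h A n (e1 A hA)]
      have a2 : ∑ A ∈ (Finset.range n).powerset, G (x + jgS h (insert n A) (n+1)) =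
          ∑ A ∈ (Finset.range n).powerset, (fun y => G (y + h n)) (x + jgS h A n) :=
        Finset.sum_congr rfl fun A hA => by rw [jgS_succ_insert h A n, ← add_assoc]
      rw [a1, a2, ih n le_rfl, ih n le_rfl (fun y => G (y + h n)), Finset.prod_range_succ, map_mul, Module.End.mul_apply,
        ← mul_add]
      have : jgAct V (jgB (-h n)) G = (1/2:ℝ) • (G + fun y => G (y + h n)) := by
        funext y
        rw [jgAct_B]
        simp only [Pi.smul_apply, Pi.add_apply, smul_eq_mul, sub_neg_eq_add]; ring
      rw [this, map_smul, map_add]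
      simp only [Pi.smul_apply, Pi.add_apply, smul_eq_mul]
      ring
    · have a2 : ∑ A ∈ (Finset.range n).powerset, G (x + jgS h (insert n A) i) =
          ∑ A ∈ (Finset.range n).powerset, G (x + jgS h A i) :=
        Finset.sum_congr rfl fun A hA => by rw [jgS_insert h A n i h1]
      rw [a2, ih i h1]; ring

theorem jg_dil (h : ℕ → V) (F : V → ℝ) (n i : ℕ) (hi : i ≤ n) (x : V) :
    ∑ A ∈ (Finset.range n).powerset, jgM h F i (x + jgS h A i)
      = 2 ^ n * jgAct V (∏ s ∈ Finset.range i, jgKap (h s)) F x := by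
  rw [jg_sumA h n i hi, jgM_act]
  have : ∏ s ∈ Finset.range i, jgKap (h s) =
      (∏ s ∈ Finset.range i, jgB (-h s)) * ∏ s ∈ Finset.range i, jgB (h s) := by
    rw [← Finset.prod_mul_distrib]
    exact Finset.prod_congr rfl fun s _ => mul_comm _ _
  rw [this, map_mul, Module.End.mul_apply]

theorem jgM_div (h : ℕ → V) (F : V → ℝ) (μ : ℝ) (n : ℕ) (y : V) :
    jgM h (fun y => F y / μ) n y = jgM h F n y / μ := by
  induction n generalizing y with
  | zero => rfl
  | succ n ih => simp only [jgM]; rw [ih, ih]; ring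

theorem jg_jump_lp (p : ℝ) (hp : 1 < p) : ∃ C : ℝ, 0 ≤ C ∧
    ∀ (V : Type) [AddCommGroup V] (h : ℕ → V) (F : V → ℝ) (_ : ∀ y, 0 ≤ F y) (n : ℕ) (μ : ℝ)
    (_ : 0 < μ),
    ∑' x, ∑ A ∈ (Finset.range n).powerset,
      ENNReal.ofReal ((jgK (fun i => jgM h F i (x + jgS h A i) / μ) n : ℝ) ^ (p/2))
      ≤ ENNReal.ofReal (C * μ ^ (-p) * 2 ^ n) * ∑' x, ENNReal.ofReal (F x ^ p) := by
  obtain ⟨C, hC, H⟩ := jg_jump p hp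
  refine ⟨C, hC, ?_⟩
  intro V _ h F hF n μ hμ
  have hF' : ∀ y, 0 ≤ F y / μ := fun y => by have := hF y; positivity
  have H1 := H V h (fun y => F y / μ) hF' n
  simp only [jgM_div] at H1
  have sw : ∀ g : Finset ℕ → V → ENNReal,
      ∑' x, ∑ A ∈ (Finset.range n).powerset, g A x =
      ∑' y, ∑ A ∈ (Finset.range n).powerset, g A (y - jgS h A n) := by
    intro g
    rw [Summable.tsum_finsetSum (fun _ _ => ENNReal.summable),
      Summable.tsum_finsetSum (fun _ _ => ENNReal.summable)]
    refine Finset.sum_congr rfl fun A _ => ?_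
    exact ((Equiv.subRight (jgS h A n)).tsum_eq (g A)).symm
  rw [sw (fun A x => ENNReal.ofReal ((jgK (fun i => jgM h F i (x + jgS h A i) / μ) n : ℝ) ^ (p/2)))]
  calc _ ≤ ∑' y, ENNReal.ofReal C * ∑ A ∈ (Finset.range n).powerset,
        ENNReal.ofReal ((F (y - jgS h A n) / μ)^p) := by
        refine ENNReal.tsum_le_tsum fun y => ?_
        rw [← ENNReal.ofReal_sum_of_nonneg (fun _ _ => by positivity),
          ← ENNReal.ofReal_sum_of_nonneg (fun A _ => by
            have := hF' (y - jgS h A n); positivity), ← ENNReal.ofReal_mul hC]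
        exact ENNReal.ofReal_le_ofReal (H1 y)
    _ = _ := by
        rw [ENNReal.tsum_mul_left, ← sw (fun A x => ENNReal.ofReal ((F x / μ)^p))]
        simp only [Finset.sum_const, Finset.card_powerset, Finset.card_range, nsmul_eq_mul]
        rw [ENNReal.tsum_mul_left]
        have : ∀ x, ENNReal.ofReal ((F x / μ)^p) = ENNReal.ofReal (μ^(-p)) * ENNReal.ofReal (F x^p) := by
          intro x
          rw [← ENNReal.ofReal_mul (by positivity), Real.div_rpow (hF x) hμ.le, Real.rpow_neg hμ.le]
          congr 1; field_simp
        simp only [this]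
        rw [ENNReal.tsum_mul_left, ENNReal.ofReal_mul (by positivity), ENNReal.ofReal_mul hC]
        have e2 : ENNReal.ofReal ((2:ℝ)^n) = ((2^n : ℕ) : ENNReal) := by
          rw [← ENNReal.ofReal_natCast]; push_cast; rfl
        rw [e2]; ring

/-- Convex combinations of products of symmetric averages along increasing chains. -/
def jgRep (I : ℕ) (k : ℕ → AddMonoidAlgebra ℝ V) : Prop :=
  ∃ (E : Type) (O : Finset E) (w : E → ℝ) (m : E → ℕ → Multiset V),
    (∀ e ∈ O, 0 ≤ w e) ∧ ∑ e ∈ O, w e = 1 ∧ (∀ e, Monotone (m e)) ∧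
    ∀ i ≤ I, k i = ∑ e ∈ O, w e • ((m e i).map jgKap).prod

theorem jgRep_one (I : ℕ) : jgRep I (fun _ => (1 : AddMonoidAlgebra ℝ V)) :=
  ⟨Unit, {()}, fun _ => 1, fun _ _ => 0, by simp, by simp, fun _ _ _ _ => le_rfl, by simp⟩

theorem jgRep_mul (I : ℕ) (k : ℕ → AddMonoidAlgebra ℝ V) (hk : jgRep I k) (a : ℕ → ℝ)
    (ha : Monotone a) (h0 : ∀ i, 0 ≤ a i) (h1 : ∀ i, a i ≤ 1) (h : V) :
    jgRep I (fun i => k i * ((1 - a i) • 1 + a i • jgKap h)) := by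
  classical
  obtain ⟨E, O, w, m, hw, hw1, hm, hk⟩ := hk
  set A : ℕ → ℝ := fun j => if j ≤ I then a j else 1 with hA
  set b : ℕ → ℝ := fun j => A j - (if j = 0 then 0 else A (j-1)) with hb
  have b0 : ∀ j, 0 ≤ b j := by
    intro j
    rcases j with _ | j
    · simp [hb, hA, h0]
    · simp only [hb, hA]
      simp only [Nat.add_eq_zero_iff, one_ne_zero, and_false, if_false, Nat.add_sub_cancel]
      split_ifs with c1 c2 c2
      · have := ha (j.le_add_right 1); linarith
      · omega
      · have := h1 j; linarith
      · simp
  have bs : ∀ n, ∑ j ∈ Finset.range (n+1), b j = A n := by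
    intro n
    induction n with
    | zero => simp [hb]
    | succ n ih => rw [Finset.sum_range_succ, ih]; simp [hb]
  have bs1 : ∑ j ∈ Finset.range (I+2), b j = 1 := by
    rw [bs]; simp [hA]
  refine ⟨E × ℕ, O ×ˢ Finset.range (I+2), fun x => w x.1 * b x.2,
    fun x i => m x.1 i + if x.2 ≤ i then {h} else 0, ?_, ?_, ?_, ?_⟩
  · intro e he
    exact mul_nonneg (hw _ (Finset.mem_product.1 he).1) (b0 _)
  · rw [Finset.sum_product]
    simp only [← Finset.mul_sum, bs1, mul_one, hw1]
  · rintro ⟨e, j⟩ i i' hi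
    apply add_le_add (hm e hi)
    simp only
    split_ifs with c1 c2
    · exact le_rfl
    · omega
    · exact bot_le
    · exact le_rfl
  · intro i hi
    rw [Finset.sum_product]
    simp only
    rw [hk i hi, Finset.sum_mul]
    refine Finset.sum_congr rfl fun e _ => ?_
    have e1 : ∀ j, ((m e i + if j ≤ i then {h} else 0).map jgKap).prod =
        ((m e i).map jgKap).prod * (1 + (if j ≤ i then (1:ℝ) else 0) • (jgKap h - 1)) := by
      intro j
      rw [Multiset.map_add, Multiset.prod_add]
      congr 1
      split_ifs <;> simp
    simp only [e1]
    have e2 : ∑ j ∈ Finset.range (I+2), b j * (if j ≤ i then (1:ℝ) else 0) = a i := by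
      have : ∑ j ∈ Finset.range (I+2), b j * (if j ≤ i then (1:ℝ) else 0)
          = ∑ j ∈ (Finset.range (I+2)).filter (· ≤ i), b j := by
        rw [Finset.sum_filter]
        exact Finset.sum_congr rfl fun j _ => by split_ifs <;> simp
      rw [this, show (Finset.range (I+2)).filter (· ≤ i) = Finset.range (i+1) by
        ext j; simp; omega, bs]
      simp [hA, hi]
    have e3 : ∀ j, (w e * b j) • (((m e i).map jgKap).prod * (1 + (if j ≤ i then (1:ℝ) else 0) • (jgKap h - 1)))
       = b j • (w e • ((m e i).map jgKap).prod) +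
         (b j * (if j ≤ i then (1:ℝ) else 0)) • (w e • (((m e i).map jgKap).prod * (jgKap h - 1))) := by
      intro j
      rw [mul_add, mul_one, smul_add, mul_smul_comm, smul_smul, smul_smul, smul_smul]
      congr 1 <;> congr 1 <;> ring
    simp only [e3]
    rw [Finset.sum_add_distrib, ← Finset.sum_smul, ← Finset.sum_smul, e2, bs1, one_smul]
    rw [smul_mul_assoc, ← smul_comm (w e), ← smul_add]
    congr 1
    rw [mul_add, mul_smul_comm, mul_smul_comm, mul_one, mul_sub, mul_one, sub_smul, smul_sub, one_smul]
    abel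

theorem jg_take_prod {R : Type*} [CommMonoid R] (g : V → R) (L : List V) (k : ℕ) (hk : k ≤ L.length) :
    ∏ s ∈ Finset.range k, g (L.getD s 0) = ((L.take k).map g).prod := by
  induction k with
  | zero => simp
  | succ k ih =>
    rw [Finset.prod_range_succ, ih (by omega), List.take_add_one]
    have : k < L.length := by omega
    simp [this]

/-- lists enumerating a chain -/
noncomputable def jgList (m : ℕ → Multiset V) [DecidableEq V] : ℕ → List V
  | 0 => (m 0).toList
  | (i+1) => jgList m i ++ (m (i+1) - m i).toList

theorem jg_chain (m : ℕ → Multiset V) (hm : Monotone m) (I : ℕ) :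
    ∃ (h : ℕ → V) (v : ℕ → ℕ) (n : ℕ), Monotone v ∧ (∀ i, v i ≤ n) ∧
      ∀ i ≤ I, ((m i).map jgKap).prod = ∏ s ∈ Finset.range (v i), jgKap (h s) := by
  classical
  have l1 : ∀ i, (jgList m i : Multiset V) = m i := by
    intro i
    induction i with
    | zero => simp [jgList]
    | succ i ih =>
      simp only [jgList]
      rw [← Multiset.coe_add, ih, Multiset.coe_toList]
      exact add_tsub_cancel_of_le (hm (i.le_add_right 1))
  have l2 : ∀ i j, jgList m i <+: jgList m (i+j) := by
    intro i j
    induction j with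
    | zero => exact List.prefix_rfl
    | succ j ih => exact ih.trans (List.prefix_append _ _)
  have l3 : ∀ i j, i ≤ j → jgList m i <+: jgList m j := by
    intro i j hij
    have := l2 i (j-i)
    rwa [Nat.add_sub_cancel' hij] at this
  refine ⟨fun s => (jgList m I).getD s 0, fun i => (jgList m (min i I)).length, (jgList m I).length,
    ?_, ?_, ?_⟩
  · intro i j hij
    exact (l3 _ _ (min_le_min_right I hij)).length_le
  · intro i
    exact (l3 _ _ (min_le_right _ _)).length_le
  · intro i hi
    have hp := l3 i I hi
    simp only [min_eq_left hi]
    rw [jg_take_prod _ _ _ hp.length_le, ← List.prefix_iff_eq_take.1 hp]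
    conv_lhs => rw [← l1 i]
    rw [Multiset.map_coe, Multiset.prod_coe]

end JGAct

section JGCore

theorem jg_core (p : ℝ) (hp : 1 < p) : ∃ C : ℝ, 0 ≤ C ∧
    ∀ (V : Type) [AddCommGroup V] (I : ℕ) (k : ℕ → AddMonoidAlgebra ℝ V) (_ : jgRep I k)
    (F : V → ℝ) (_ : ∀ y, 0 ≤ F y) (lam : ℝ) (_ : 0 < lam) (X : Finset V) (S : V → Finset ℕ)
    (v : V → ℕ → ℕ) (_ : ∀ x, Monotone (v x)) (_ : ∀ x i, v x i ≤ I)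
    (_ : ∀ x ∈ X, ∀ i ∈ S x, 4 * lam ≤ |jgAct V (k (v x (i+1))) F x - jgAct V (k (v x i)) F x|),
    ∑ x ∈ X, ENNReal.ofReal (((S x).card : ℝ)^(p/2)) ≤
      ENNReal.ofReal (C * lam ^ (-p)) * ∑' x, ENNReal.ofReal (F x ^ p) := by
  obtain ⟨C1, hC1, H1⟩ := jg_jump_lp p hp
  obtain ⟨C2, γ, hC2, hγ, H2⟩ := jg_avg p hp
  have r1 : (2:ℝ)^(γ-p) < 1 := Real.rpow_lt_one_of_one_lt_of_neg (by norm_num) (by linarith)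
  refine ⟨C1 * C2 * (1 - (2:ℝ)^(γ-p))⁻¹, by
    have : 0 < (1 - (2:ℝ)^(γ-p)) := by linarith
    positivity, ?_⟩
  intro V _ I k hk F hF lam hlam X S v hv hvI hjump
  obtain ⟨E, O, w, m, hw, hw1, hm, hk⟩ := hk
  choose h ν n hν hνn hprod using fun e => jg_chain (m e) (hm e) I
  set O' : Finset (Σ _ : E, Finset ℕ) := O.sigma (fun e => (Finset.range (n e)).powerset) with hO'
  set w' : (Σ _ : E, Finset ℕ) → ℝ := fun o => w o.1 / 2 ^ (n o.1) with hw'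
  have w0 : ∀ o ∈ O', 0 ≤ w' o := by
    intro o ho
    have := hw _ (Finset.mem_sigma.1 ho).1
    simp only [hw']; positivity
  have w1 : ∑ o ∈ O', w' o = 1 := by
    rw [hO', Finset.sum_sigma, ← hw1]
    refine Finset.sum_congr rfl fun e _ => ?_
    simp [hw']
    field_simp
  -- the dilated paths
  set z : V → (Σ _ : E, Finset ℕ) → ℕ → ℝ := fun x o s => jgM (h o.1) F s (x + jgS (h o.1) o.2 s) with hz
  have act : ∀ x, ∀ i ≤ I, jgAct V (k i) F x = ∑ o ∈ O', w' o * z x o (ν o.1 i) := by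
    intro x i hi
    rw [hk i hi, map_sum, LinearMap.sum_apply, Finset.sum_apply, hO', Finset.sum_sigma]
    refine Finset.sum_congr rfl fun e _ => ?_
    simp only [hw', hz]
    rw [← Finset.mul_sum, jg_dil _ _ _ _ (hνn e i), hprod e i hi, map_smul, LinearMap.smul_apply,
      Pi.smul_apply, smul_eq_mul]
    field_simp
  set K : V → ℕ → (Σ _ : E, Finset ℕ) → ℕ := fun x l o =>
    jgK (fun s => z x o s / (2^l * lam)) (n o.1) with hK
  have step : ∀ x ∈ X, ∃ l : ℕ, ((S x).card : ℝ)^(p/2) ≤ C2 * (2:ℝ)^(γ * l) *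
      ∑ o ∈ O', w' o * (K x l o : ℝ)^(p/2) := by
    intro x hx
    refine H2 _ O' w' (fun o i => z x o (ν o.1 (v x i))) (S x) lam (K x) hlam w0 w1 ?_ ?_
    · intro i hi
      have := hjump x hx i hi
      rw [act x _ (hvI x _), act x _ (hvI x _), ← Finset.sum_sub_distrib] at this
      simpa only [← mul_sub] using this
    · intro l o ho
      refine jg_count _ (n o.1) (fun i => ν o.1 (v x i)) ((hν o.1).comp (hv x)) (fun i => hνn _ _) _ ?_
      intro i hi
      have := (Finset.mem_filter.1 hi).2
      have pos : 0 < 2^l * lam := by positivity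
      rw [← sub_div, abs_div, abs_of_pos pos, le_div_iff₀ pos]
      rw [pow_succ] at this
      linarith
  have step2 : ∀ x ∈ X, ENNReal.ofReal (((S x).card : ℝ)^(p/2)) ≤
      ∑' l : ℕ, ENNReal.ofReal (C2 * (2:ℝ)^(γ * l)) *
      ∑ e ∈ O, ENNReal.ofReal (w e / 2^(n e)) * ∑ A ∈ (Finset.range (n e)).powerset,
        ENNReal.ofReal ((K x l ⟨e, A⟩ : ℝ)^(p/2)) := by
    intro x hx
    obtain ⟨l, hl⟩ := step x hx
    refine (ENNReal.ofReal_le_ofReal hl).trans (le_trans (le_of_eq ?_) (ENNReal.le_tsum l))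
    rw [ENNReal.ofReal_mul (by positivity)]
    congr 1
    rw [hO', Finset.sum_sigma, ENNReal.ofReal_sum_of_nonneg]
    · refine Finset.sum_congr rfl fun e he => ?_
      have := hw e he
      simp only [hw']
      rw [← Finset.mul_sum, ENNReal.ofReal_mul (by positivity), ENNReal.ofReal_sum_of_nonneg]
      intro A _; positivity
    · intro e he
      have := hw e he
      refine Finset.sum_nonneg fun A _ => ?_
      simp only [hw']
      positivity
  have fin : ∀ l : ℕ, ∑' x, ∑ e ∈ O, ENNReal.ofReal (w e / 2^(n e)) *
        ∑ A ∈ (Finset.range (n e)).powerset, ENNReal.ofReal ((K x l ⟨e, A⟩ : ℝ)^(p/2)) ≤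
      ENNReal.ofReal (C1 * (2^l * lam)^(-p)) * ∑' x, ENNReal.ofReal (F x ^ p) := by
    intro l
    rw [Summable.tsum_finsetSum (fun _ _ => ENNReal.summable)]
    simp only [ENNReal.tsum_mul_left]
    calc _ ≤ ∑ e ∈ O, ENNReal.ofReal (w e / 2^(n e)) * (ENNReal.ofReal (C1 * (2^l * lam) ^ (-p) * 2 ^ (n e))
          * ∑' x, ENNReal.ofReal (F x ^ p)) := by
          refine Finset.sum_le_sum fun e he => mul_le_mul_right ?_ _
          exact H1 V (h e) F hF (n e) (2^l * lam) (by positivity)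
      _ = ∑ e ∈ O, ENNReal.ofReal (w e) * (ENNReal.ofReal (C1 * (2^l * lam)^(-p)) * ∑' x, ENNReal.ofReal (F x ^ p)) := by
          refine Finset.sum_congr rfl fun e he => ?_
          have := hw e he
          rw [← mul_assoc, ← mul_assoc, ← ENNReal.ofReal_mul (by positivity), ← ENNReal.ofReal_mul (by positivity)]
          congr 2
          field_simp
      _ = _ := by
          rw [← Finset.sum_mul, ← ENNReal.ofReal_sum_of_nonneg hw, hw1]; simp
  calc ∑ x ∈ X, ENNReal.ofReal (((S x).card : ℝ)^(p/2)) ≤ _ := Finset.sum_le_sum step2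
    _ ≤ _ := ENNReal.sum_le_tsum X
    _ = ∑' l : ℕ, ENNReal.ofReal (C2 * (2:ℝ)^(γ * l)) * _ := by
      rw [ENNReal.tsum_comm]
      simp only [ENNReal.tsum_mul_left]
    _ ≤ ∑' l : ℕ, ENNReal.ofReal (C2 * (2:ℝ)^(γ * l)) *
        (ENNReal.ofReal (C1 * (2^l * lam)^(-p)) * ∑' x, ENNReal.ofReal (F x ^ p)) :=
      ENNReal.tsum_le_tsum fun l => mul_le_mul_right (fin l) _
    _ = _ := by
      have e : ∀ l : ℕ, ENNReal.ofReal (C2 * (2:ℝ)^(γ * l)) *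
        (ENNReal.ofReal (C1 * (2^l * lam)^(-p)) * ∑' x, ENNReal.ofReal (F x ^ p)) =
        ENNReal.ofReal ((C1 * C2 * lam ^ (-p)) * ((2:ℝ)^(γ-p))^l) * ∑' x, ENNReal.ofReal (F x ^ p) := by
        intro l
        rw [← mul_assoc, ← ENNReal.ofReal_mul (by positivity)]
        congr 2
        rw [Real.mul_rpow (by positivity) hlam.le, ← Real.rpow_natCast 2 l, ← Real.rpow_natCast _ l,
          ← Real.rpow_mul (by norm_num), ← Real.rpow_mul (by norm_num),
          show (γ - p) * (l:ℝ) = γ * l + l * (-p) by ring, Real.rpow_add (by norm_num)]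
        ring
      simp only [e]
      rw [ENNReal.tsum_mul_right, ← ENNReal.ofReal_tsum_of_nonneg (fun l => by positivity)
        ((summable_geometric_of_lt_one (by positivity) r1).mul_left _), tsum_mul_left,
        tsum_geometric_of_lt_one (by positivity) r1]
      congr 2; ring
end JGCore

section JGTheta
open Filter Topology

/-- normalized coefficients -/
noncomputable def jgC (q : ℝ) : ℕ → ℤ → ℝ
  | 0, k => if k = 0 then 1 else 0
  | (n+1), k => ((1 + (q^(2*n+1))^2) * jgC q n k + q^(2*n+1) * (jgC q n (k-1) + jgC q n (k+1)))
      / (1 + q^(2*n+1))^2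

theorem jgC_supp (q : ℝ) (n : ℕ) (k : ℤ) (hk : (n:ℤ) < |k|) : jgC q n k = 0 := by
  induction n generalizing k with
  | zero =>
    have : k ≠ 0 := by rintro rfl; simp at hk
    simp [jgC, this]
  | succ n ih =>
    push_cast at hk
    simp only [jgC]
    rw [ih k (by omega), ih (k-1) (by
      rcases abs_cases k with h | h <;> rcases abs_cases (k-1) with h' | h' <;> omega), ih (k+1) (by
      rcases abs_cases k with h | h <;> rcases abs_cases (k+1) with h' | h' <;> omega)]
    simp

theorem jgC_nonneg (q : ℝ) (hq : 0 < q) (n : ℕ) (k : ℤ) : 0 ≤ jgC q n k := by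
  induction n generalizing k with
  | zero => simp only [jgC]; split_ifs <;> norm_num
  | succ n ih =>
    simp only [jgC]
    have := ih k; have := ih (k-1); have := ih (k+1)
    positivity

theorem jgC_pos (q : ℝ) (hq : 0 < q) (n : ℕ) : 0 < jgC q n 0 := by
  induction n with
  | zero => simp [jgC]
  | succ n ih =>
    simp only [jgC]
    have := jgC_nonneg q hq n (0-1); have := jgC_nonneg q hq n (0+1)
    positivity

theorem jgC_neg (q : ℝ) (n : ℕ) (k : ℤ) : jgC q n (-k) = jgC q n k := by
  induction n generalizing k with
  | zero => simp [jgC]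
  | succ n ih =>
    simp only [jgC]
    rw [ih k, show -k - 1 = -(k+1) by ring, show -k + 1 = -(k-1) by ring, ih, ih,
      add_comm (jgC q n (k+1))]

theorem jgC_rel (q : ℝ) (hq : 0 < q) (n : ℕ) (k : ℤ) :
    jgC q n (k+1) * (1 - (q^n)^2 * (q^k)^2 * q^2) = q * ((q^k)^2 - (q^n)^2) * jgC q n k := by
  induction n generalizing k with
  | zero =>
    simp only [jgC]
    by_cases h0 : k = 0
    · simp [h0]
    · by_cases h1 : k = -1
      · subst h1
        simp
        field_simp
        simp
      · have : k + 1 ≠ 0 := by omega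
        simp [h0, this]
  | succ n ih =>
    have r1 := ih (k-1)
    have r2 := ih k
    have r3 := ih (k+1)
    simp only [jgC]
    rw [show k + 1 - 1 = k by ring]
    rw [show k - 1 + 1 = k by ring, zpow_sub_one₀ hq.ne'] at r1
    rw [zpow_add_one₀ hq.ne'] at r3
    rw [show q^(2*n+1) = (q^n)^2 * q by ring, show q^(n+1) = q^n * q by ring]
    set A := q^k with hA
    set N := q^n with hN
    have hN0 : 0 < N := by positivity
    generalize jgC q n (k-1) = c0 at *
    generalize jgC q n k = c1 at *
    generalize jgC q n (k+1) = c2 at *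
    generalize jgC q n (k+1+1) = c3 at *
    have r1' : q * c1 * (1 - N^2*A^2) = (A^2 - N^2*q^2) * c0 := by
      field_simp at r1
      linear_combination r1
    have hd : (1 + N^2*q)^2 ≠ 0 := by positivity
    rw [div_mul_eq_mul_div, mul_div_assoc', div_left_inj' hd]
    linear_combination (N^2*q^2) * r1' + (1 + N^4*q^4) * r2 + (N^2*q) * r3

theorem jgC_le (q : ℝ) (hq : 0 < q) (hq1 : q < 1) (n : ℕ) (k : ℕ) :
    jgC q n k ≤ q^(k^2) * jgC q n 0 := by
  induction k with
  | zero => simp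
  | succ k ih =>
    have r := jgC_rel q hq n k
    rw [zpow_natCast] at r
    push_cast
    have c0 := jgC_nonneg q hq n k
    have A1 : (q^k)^2 ≤ 1 := pow_le_one₀ (by positivity) (pow_le_one₀ hq.le hq1.le)
    have N1 : (q^n)^2 ≤ 1 := pow_le_one₀ (by positivity) (pow_le_one₀ hq.le hq1.le)
    have q1 : q^2 < 1 := pow_lt_one₀ hq.le hq1 (by norm_num)
    have hA : 0 < (q^k)^2 := by positivity
    have hN : 0 < (q^n)^2 := by positivity
    set A := (q^k)^2
    set N := (q^n)^2
    have NA : N * A ≤ 1 := mul_le_one₀ N1 hA.le A1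
    have d : 0 < 1 - N * A * q^2 := by
      have : N * A * q^2 ≤ 1 * q^2 := by gcongr
      linarith
    have h1 : A - N ≤ A * (1 - N * A * q^2) := by
      have : A * (A * q^2) ≤ 1 := mul_le_one₀ A1 (by positivity) (mul_le_one₀ A1 (by positivity) q1.le)
      nlinarith
    have h2 : jgC q n (k+1) * (1 - N * A * q^2) ≤ (q * A * jgC q n k) * (1 - N * A * q^2) := by
      rw [r]
      have : q * (A - N) * jgC q n k ≤ q * (A * (1 - N * A * q^2)) * jgC q n k := by gcongr
      linarith
    have h3 := le_of_mul_le_mul_right h2 d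
    calc _ ≤ q * A * jgC q n k := h3
      _ ≤ q * A * (q^(k^2) * jgC q n 0) := by gcongr
      _ = _ := by simp only [A]; ring

theorem jgC_lim (q : ℝ) (hq : 0 < q) (hq1 : q < 1) (k : ℕ) :
    Tendsto (fun n => jgC q n k / jgC q n 0) atTop (𝓝 (q^(k^2))) := by
  induction k with
  | zero =>
    have : (fun n => jgC q n ((0:ℕ):ℤ) / jgC q n 0) = fun _ => 1 := by
      funext n; exact div_self (jgC_pos q hq n).ne'
    rw [this]; simp
  | succ k ih =>
    have hN : Tendsto (fun n : ℕ => (q^n)^2) atTop (𝓝 0) := by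
      have := (tendsto_pow_atTop_nhds_zero_of_lt_one hq.le hq1).pow 2
      simpa using this
    have hA1 : (q^k)^2 ≤ 1 := pow_le_one₀ (by positivity) (pow_le_one₀ hq.le hq1.le)
    have q1 : q^2 < 1 := pow_lt_one₀ hq.le hq1 (by norm_num)
    have e : ∀ n : ℕ, jgC q n ((k+1 : ℕ):ℤ) / jgC q n 0 =
        (q * ((q^k)^2 - (q^n)^2) / (1 - (q^n)^2 * (q^k)^2 * q^2)) * (jgC q n k / jgC q n 0) := by
      intro n
      have r := jgC_rel q hq n k
      rw [zpow_natCast] at r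
      push_cast
      have N1 : (q^n)^2 ≤ 1 := pow_le_one₀ (by positivity) (pow_le_one₀ hq.le hq1.le)
      have d : 0 < 1 - (q^n)^2 * (q^k)^2 * q^2 := by
        have : (q^n)^2 * (q^k)^2 * q^2 ≤ 1 * 1 * q^2 := by gcongr
        linarith
      have := jgC_pos q hq n
      rw [div_mul_div_comm, div_eq_div_iff this.ne' (by positivity)]
      linear_combination (jgC q n 0) * r
    simp only [e]
    have l1 : Tendsto (fun n : ℕ => q * ((q^k)^2 - (q^n)^2) / (1 - (q^n)^2 * (q^k)^2 * q^2)) atTop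
        (𝓝 (q * ((q^k)^2 - 0) / (1 - 0 * (q^k)^2 * q^2))) := by
      apply Tendsto.div
      · exact (tendsto_const_nhds.sub hN).const_mul q
      · exact tendsto_const_nhds.sub ((hN.mul_const _).mul_const _)
      · simp
    have := l1.mul ih
    convert this using 2
    simp; ring

theorem jgC_le' (q : ℝ) (hq : 0 < q) (hq1 : q < 1) (n : ℕ) (k : ℤ) :
    jgC q n k ≤ q^(k.natAbs^2) * jgC q n 0 := by
  rcases Int.natAbs_eq k with h | h
  · conv_lhs => rw [h]
    exact jgC_le q hq hq1 n _
  · conv_lhs => rw [h, jgC_neg]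
    exact jgC_le q hq hq1 n _

theorem jgC_lim' (q : ℝ) (hq : 0 < q) (hq1 : q < 1) (k : ℤ) :
    Tendsto (fun n => jgC q n k / jgC q n 0) atTop (𝓝 (q^(k.natAbs^2))) := by
  rcases Int.natAbs_eq k with h | h
  · have := jgC_lim q hq hq1 k.natAbs
    rwa [← h] at this
  · have := jgC_lim q hq hq1 k.natAbs
    have e : ∀ n, jgC q n k = jgC q n (k.natAbs : ℤ) := by
      intro n
      conv_lhs => rw [h, jgC_neg]
    simpa only [e] using this

theorem jg_summable (q : ℝ) (hq : 0 < q) (hq1 : q < 1) : Summable (fun k : ℤ => q^(k.natAbs^2)) := by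
  have h : Summable (fun n : ℕ => q^(n^2)) := by
    refine Summable.of_nonneg_of_le (fun n => by positivity) (fun n => ?_)
      (summable_geometric_of_lt_one hq.le hq1)
    exact pow_le_pow_of_le_one hq.le hq1.le (Nat.le_self_pow (by norm_num) n)
  refine Summable.of_nat_of_neg ?_ ?_ <;> simpa using h

variable {V : Type} [AddCommGroup V]

theorem jgKap_eq (h : V) : jgKap h = (1/2:ℝ) • 1 +
    (1/4:ℝ) • (AddMonoidAlgebra.single h 1 + AddMonoidAlgebra.single (-h) 1) := by
  unfold jgKap jgB
  rw [smul_mul_smul_comm, mul_add, mul_one, add_mul, AddMonoidAlgebra.single_mul_single, one_mul]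
  rw [add_neg_cancel, mul_one, ← AddMonoidAlgebra.one_def]
  module

/-- one factor -/
noncomputable def jgFac (q : ℝ) (m : ℕ) (h : V) : AddMonoidAlgebra ℝ V :=
  (1 - 4 * q^(2*m+1) / (1 + q^(2*m+1))^2) • 1 + (4 * q^(2*m+1) / (1 + q^(2*m+1))^2) • jgKap h

theorem jgFac_eq (q : ℝ) (hq : 0 < q) (m : ℕ) (h : V) : jgFac q m h =
    ((1 + (q^(2*m+1))^2)/(1 + q^(2*m+1))^2) • 1 + (q^(2*m+1) / (1 + q^(2*m+1))^2) •
     (AddMonoidAlgebra.single h 1 + AddMonoidAlgebra.single (-h) 1) := by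
  unfold jgFac
  rw [jgKap_eq]
  have : 0 < q^(2*m+1) := by positivity
  set Q := q^(2*m+1)
  rw [smul_add, smul_smul, smul_smul, ← add_assoc, ← add_smul]
  congr 2
  · field_simp; ring
  · field_simp

theorem jgProd_eq (q : ℝ) (hq : 0 < q) (n : ℕ) (h : V) :
    ∏ m ∈ Finset.range n, jgFac q m h =
      ∑ k ∈ Finset.Icc (-(n:ℤ)) n, AddMonoidAlgebra.single (k • h) (jgC q n k) := by
  have ext : ∀ n N : ℕ, n ≤ N → ∑ k ∈ Finset.Icc (-(n:ℤ)) n, AddMonoidAlgebra.single (k • h) (jgC q n k)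
      = ∑ k ∈ Finset.Icc (-(N:ℤ)) N, AddMonoidAlgebra.single (k • h) (jgC q n k) := by
    intro n N hN
    apply Finset.sum_subset
    · intro k; simp only [Finset.mem_Icc]; omega
    · intro k _ hk
      rw [jgC_supp, AddMonoidAlgebra.single_zero]
      simp only [Finset.mem_Icc] at hk
      rcases abs_cases k with h | h <;> omega
  have sh : ∀ n : ℕ, ∀ s : ℤ, |s| ≤ 1 → ∑ k ∈ Finset.Icc (-((n+1:ℕ):ℤ)) (n+1:ℕ), AddMonoidAlgebra.single ((k + s) • h) (jgC q n k)
      = ∑ k ∈ Finset.Icc (-((n+1:ℕ):ℤ)) (n+1:ℕ), AddMonoidAlgebra.single (k • h) (jgC q n (k - s)) := by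
    intro n s hs
    have e1 : ∑ k ∈ Finset.Icc (-((n+1:ℕ):ℤ)) (n+1:ℕ), AddMonoidAlgebra.single ((k + s) • h) (jgC q n k)
      = ∑ k ∈ Finset.Icc (-((n+2:ℕ):ℤ)) (n+2:ℕ), AddMonoidAlgebra.single (k • h) (jgC q n (k-s)) := by
      refine Finset.sum_bij_ne_zero (fun k _ _ => k + s) ?_ ?_ ?_ ?_
      · intro k hk _
        simp only [Finset.mem_Icc] at *
        push_cast at *
        rcases abs_cases s with h | h <;> omega
      · intro a _ _ b _ _ h; simpa using h
      · intro k hk hne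
        refine ⟨k - s, ?_, ?_, by simp⟩
        · by_contra hcon
          apply hne
          rw [jgC_supp, AddMonoidAlgebra.single_zero]
          simp only [Finset.mem_Icc] at hcon
          push_cast at hcon
          rcases abs_cases (k-s) with h | h <;> omega
        · simpa using hne
      · intro k _ _; simp
    rw [e1]
    symm
    apply Finset.sum_subset
    · intro k; simp only [Finset.mem_Icc]; push_cast; omega
    · intro k hk hk'
      rw [jgC_supp, AddMonoidAlgebra.single_zero]
      simp only [Finset.mem_Icc] at hk hk'
      push_cast at hk hk'
      rcases abs_cases s with h | h <;> rcases abs_cases (k-s) with h' | h' <;> omega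
  induction n with
  | zero => simp [jgC, AddMonoidAlgebra.one_def]
  | succ n ih =>
    rw [Finset.prod_range_succ, ih, ext n (n+1) (by omega), jgFac_eq q hq]
    rw [mul_add, mul_smul_comm, mul_smul_comm, mul_one, mul_add, Finset.sum_mul, Finset.sum_mul]
    simp only [AddMonoidAlgebra.single_mul_single, mul_one]
    have a1 := sh n 1 (by norm_num)
    have a2 := sh n (-1) (by norm_num)
    simp only [add_smul, one_smul, neg_smul] at a1 a2
    rw [a1, a2, ← Finset.sum_add_distrib, Finset.smul_sum, Finset.smul_sum, ← Finset.sum_add_distrib]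
    refine Finset.sum_congr rfl fun k _ => ?_
    rw [← AddMonoidAlgebra.single_add, AddMonoidAlgebra.smul_single, AddMonoidAlgebra.smul_single,
      ← AddMonoidAlgebra.single_add]
    congr 1
    simp only [jgC, smul_eq_mul, sub_neg_eq_add]
    ring

theorem jgC_sum (q : ℝ) (hq : 0 < q) (n : ℕ) : ∑ k ∈ Finset.Icc (-(n:ℤ)) n, jgC q n k = 1 := by
  have h1 := congrArg (fun K => jgAct ℤ K (fun _ => 1) 0) (jgProd_eq q hq n (1:ℤ))
  simp only [map_sum, LinearMap.sum_apply, Finset.sum_apply, jgAct_single, mul_one] at h1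
  rw [← h1]
  have : ∀ n : ℕ, jgAct ℤ (∏ m ∈ Finset.range n, jgFac q m (1:ℤ)) (fun _ => 1) = fun _ => 1 := by
    intro n
    induction n with
    | zero => simp
    | succ n ih =>
      rw [Finset.prod_range_succ, mul_comm, map_mul, Module.End.mul_apply, ih]
      unfold jgFac jgKap
      funext x
      simp only [map_add, map_smul, map_mul, map_one, LinearMap.add_apply, LinearMap.smul_apply,
        Module.End.mul_apply, Pi.add_apply, Pi.smul_apply, jgAct_B, Module.End.one_apply, smul_eq_mul]
      ring
  rw [this n]

theorem jgC_tendsto (q : ℝ) (hq : 0 < q) (hq1 : q < 1) (k : ℤ) :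
    Tendsto (fun n => jgC q n k) atTop (𝓝 (q^(k.natAbs^2) / ∑' j : ℤ, q^(j.natAbs^2))) := by
  have s := jg_summable q hq hq1
  have hs : Tendsto (fun n => ∑' j : ℤ, jgC q n j / jgC q n 0) atTop (𝓝 (∑' j : ℤ, q^(j.natAbs^2))) := by
    refine tendsto_tsum_of_dominated_convergence s (fun j => jgC_lim' q hq hq1 j) ?_
    refine Eventually.of_forall fun n j => ?_
    have := jgC_nonneg q hq n j
    have := jgC_pos q hq n
    rw [Real.norm_of_nonneg (by positivity), div_le_iff₀ (by positivity)]
    exact jgC_le' q hq hq1 n j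
  have e : ∀ n, ∑' j : ℤ, jgC q n j / jgC q n 0 = 1 / jgC q n 0 := by
    intro n
    rw [tsum_eq_sum (s := Finset.Icc (-(n:ℤ)) n), ← Finset.sum_div, jgC_sum q hq n]
    intro j hj
    rw [jgC_supp, zero_div]
    simp only [Finset.mem_Icc] at hj
    rcases abs_cases j with h | h <;> omega
  simp only [e] at hs
  have pos : 0 < ∑' j : ℤ, q^(j.natAbs^2) := s.tsum_pos (fun j => by positivity) 0 (by simp)
  have := (jgC_lim' q hq hq1 k).div hs pos.ne'
  refine this.congr fun n => ?_
  have := jgC_pos q hq n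
  simp only [Pi.div_apply]
  field_simp

theorem jgC_bd (q : ℝ) (hq : 0 < q) (hq1 : q < 1) (n : ℕ) (k : ℤ) :
    jgC q n k ≤ q^(k.natAbs^2) := by
  have h1 : jgC q n 0 ≤ 1 := by
    rw [← jgC_sum q hq n]
    exact Finset.single_le_sum (f := fun k => jgC q n k) (fun k _ => jgC_nonneg q hq n k) (by simp)
  exact (jgC_le' q hq hq1 n k).trans (mul_le_of_le_one_right (by positivity) h1)

end JGTheta

section JGKer
open Filter Topology

/-- product kernel -/
noncomputable def jgKer (d n : ℕ) (q : ℝ) : AddMonoidAlgebra ℝ (Fin d → ℤ) :=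
  ∏ j : Fin d, ∏ m ∈ Finset.range n, jgFac q m (Pi.single j 1 : Fin d → ℤ)

theorem jgKer_rep (d n I : ℕ) (q : ℕ → ℝ) (hq : Monotone q) (h0 : ∀ i, 0 < q i) (h1 : ∀ i, q i < 1) :
    jgRep I (fun i => jgKer d n (q i)) := by
  unfold jgKer
  have inner : ∀ (h : Fin d → ℤ) (k : ℕ → AddMonoidAlgebra ℝ (Fin d → ℤ)), jgRep I k → ∀ n,
      jgRep I (fun i => k i * ∏ m ∈ Finset.range n, jgFac (q i) m h) := by
    intro h k hk n
    induction n with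
    | zero => simpa using hk
    | succ n ih =>
      have := jgRep_mul I _ ih (fun i => 4 * (q i)^(2*n+1) / (1 + (q i)^(2*n+1))^2) ?_ ?_ ?_ h
      · simp only [Finset.prod_range_succ, ← mul_assoc]
        exact this
      · intro i j hij
        have a0 : 0 < (q i)^(2*n+1) := pow_pos (h0 i) _
        have b0 : 0 < (q j)^(2*n+1) := pow_pos (h0 j) _
        have a1 : (q i)^(2*n+1) ≤ 1 := pow_le_one₀ (h0 i).le (h1 i).le
        have b1 : (q j)^(2*n+1) ≤ 1 := pow_le_one₀ (h0 j).le (h1 j).le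
        have ab : (q i)^(2*n+1) ≤ (q j)^(2*n+1) := pow_le_pow_left₀ (h0 i).le (hq hij) _
        simp only
        generalize (q i)^(2*n+1) = a at *
        generalize (q j)^(2*n+1) = b at *
        rw [div_le_div_iff₀ (by positivity) (by positivity)]
        have : 0 ≤ (b - a) * (1 - a * b) := mul_nonneg (by linarith) (by nlinarith)
        nlinarith
      · intro i
        have := h0 i
        positivity
      · intro i
        have := h0 i
        have a0 : 0 < (q i)^(2*n+1) := pow_pos (h0 i) _
        generalize (q i)^(2*n+1) = a at *
        rw [div_le_one (by positivity)]
        nlinarith [sq_nonneg (1-a)]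
  have : ∀ s : Finset (Fin d), jgRep I (fun i => ∏ j ∈ s, ∏ m ∈ Finset.range n, jgFac (q i) m (Pi.single j 1 : Fin d → ℤ)) := by
    intro s
    classical
    induction s using Finset.induction_on with
    | empty => simpa using jgRep_one I
    | insert j s hj ih =>
      simp only [Finset.prod_insert hj]
      have := inner (Pi.single j 1) _ ih n
      simpa only [mul_comm] using this
  exact this _

theorem jg_prod_single {d : ℕ} (s : Finset (Fin d)) (v : Fin d → (Fin d → ℤ)) (c : Fin d → ℝ) :
    ∏ j ∈ s, (AddMonoidAlgebra.single (v j) (c j) : AddMonoidAlgebra ℝ (Fin d → ℤ)) =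
      AddMonoidAlgebra.single (∑ j ∈ s, v j) (∏ j ∈ s, c j) := by
  classical
  induction s using Finset.induction_on with
  | empty => simp [AddMonoidAlgebra.one_def]
  | insert j s hj ih =>
    rw [Finset.prod_insert hj, Finset.sum_insert hj, Finset.prod_insert hj, ih,
      AddMonoidAlgebra.single_mul_single]

/-- the box -/
noncomputable def jgBox (d n : ℕ) : Finset (Fin d → ℤ) := Fintype.piFinset fun _ => Finset.Icc (-(n:ℤ)) n

theorem jgKer_act (d n : ℕ) (q : ℝ) (hq : 0 < q) (F : (Fin d → ℤ) → ℝ) (x : Fin d → ℤ) :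
    jgAct _ (jgKer d n q) F x = ∑ k ∈ jgBox d n, (∏ j, jgC q n (k j)) * F (x - k) := by
  classical
  unfold jgKer
  simp only [jgProd_eq q hq]
  rw [Finset.prod_univ_sum, map_sum, LinearMap.sum_apply, Finset.sum_apply]
  refine Finset.sum_congr rfl fun k _ => ?_
  rw [jg_prod_single, jgAct_single]
  congr 3
  conv_rhs => rw [← Finset.univ_sum_single k]
  refine Finset.sum_congr rfl fun j _ => ?_
  rw [← Pi.single_smul]; simp

theorem jg_summable_pi (d : ℕ) (g : ℤ → ℝ) (hg : ∀ k, 0 ≤ g k) (hs : Summable g) :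
    Summable (fun k : Fin d → ℤ => ∏ j, g (k j)) := by
  classical
  refine summable_of_sum_le (c := ∏ _j : Fin d, ∑' k, g k) (fun k => Finset.prod_nonneg fun j _ => hg _) ?_
  intro s
  calc ∑ k ∈ s, ∏ j, g (k j) ≤ ∑ k ∈ Fintype.piFinset (fun j => s.image (fun k => k j)), ∏ j, g (k j) := by
        apply Finset.sum_le_sum_of_subset_of_nonneg
        · intro k hk
          rw [Fintype.mem_piFinset]
          intro j
          exact Finset.mem_image_of_mem _ hk
        · intro k _ _; exact Finset.prod_nonneg fun j _ => hg _
    _ = ∏ j : Fin d, ∑ k ∈ s.image (fun k => k j), g k := (Finset.prod_univ_sum _ _).symm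
    _ ≤ _ := Finset.prod_le_prod (fun j _ => Finset.sum_nonneg fun k _ => hg k)
        (fun j _ => hs.sum_le_tsum _ (fun k _ => hg k))

/-- approximants -/
noncomputable def jgPhi (d n : ℕ) (q : ℝ) (f : (Fin d → ℤ) → ℂ) (x : Fin d → ℤ) : ℂ :=
  ∑ k ∈ jgBox d n, ((∏ j, jgC q n (k j) : ℝ) : ℂ) * f (x - k)

theorem jgPhi_tendsto (d : ℕ) (t : ℝ) (ht : 0 < t) (f : (Fin d → ℤ) → ℂ) (B : ℝ)
    (hB : ∀ x, ‖f x‖ ≤ B) (x : Fin d → ℤ) :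
    Tendsto (fun n => jgPhi d n (Real.exp (-π/t)) f x) atTop (𝓝 (gConv d t f x)) := by
  set q := Real.exp (-π/t) with hq
  have q0 : 0 < q := Real.exp_pos _
  have q1 : q < 1 := by
    rw [hq, Real.exp_lt_one_iff]
    exact div_neg_of_neg_of_pos (by linarith [Real.pi_pos]) ht
  have qk : ∀ k : ℤ, q^(k.natAbs^2) = Real.exp (-π * (k:ℝ)^2 / t) := by
    intro k
    rw [hq, ← Real.exp_nat_mul]
    congr 1
    push_cast
    rw [Nat.cast_natAbs]
    push_cast
    rw [sq_abs]; ring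
  have th : theta (1/t) 0 = ∑' k : ℤ, q^(k.natAbs^2) := by
    unfold theta
    congr 1; funext k
    rw [qk]; congr 1; ring
  have ga : ∀ k : Fin d → ℤ, gauss d t k = ∏ j, (q^((k j).natAbs^2) / ∑' i : ℤ, q^(i.natAbs^2)) := by
    intro k
    unfold gauss bigTheta
    simp only [Pi.zero_apply, th, qk]
    rw [Finset.prod_div_distrib, ← Real.exp_sum, mul_comm, div_eq_mul_inv]
    congr 2
    rw [Finset.mul_sum, ← div_eq_mul_inv, Finset.sum_div]
  have e : ∀ n, jgPhi d n q f x = ∑' k : Fin d → ℤ, ((∏ j, jgC q n (k j) : ℝ) : ℂ) * f (x - k) := by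
    intro n
    unfold jgPhi
    rw [tsum_eq_sum]
    intro k hk
    unfold jgBox at hk
    rw [Fintype.mem_piFinset] at hk
    push Not at hk
    obtain ⟨j, hj⟩ := hk
    have : jgC q n (k j) = 0 := by
      apply jgC_supp
      simp only [Finset.mem_Icc] at hj
      rcases abs_cases (k j) with h | h <;> omega
    rw [Finset.prod_eq_zero (Finset.mem_univ j) this]; simp
  simp only [e]
  unfold gConv
  have s := (jg_summable_pi d _ (fun k => by positivity) (jg_summable q q0 q1)).mul_right B
  refine tendsto_tsum_of_dominated_convergence s ?_ ?_
  · intro k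
    apply Tendsto.mul_const
    rw [ga]
    apply (Complex.continuous_ofReal.tendsto _).comp
    exact tendsto_finsetProd _ fun j _ => jgC_tendsto q q0 q1 (k j)
  · refine Eventually.of_forall fun n k => ?_
    rw [norm_mul, Complex.norm_real, Real.norm_of_nonneg (Finset.prod_nonneg fun j _ => jgC_nonneg q q0 n _)]
    apply mul_le_mul _ (hB _) (norm_nonneg _) (Finset.prod_nonneg fun j _ => by positivity)
    exact Finset.prod_le_prod (fun j _ => jgC_nonneg q q0 n _) fun j _ => jgC_bd q q0 q1 n _

/-- the four nonnegative parts -/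
noncomputable def jgPart {V : Type} (f : V → ℂ) (c : Fin 4) (x : V) : ℝ :=
  max ((![(f x).re, -(f x).re, (f x).im, -(f x).im] : Fin 4 → ℝ) c) 0

theorem jgPart_nonneg {V : Type} (f : V → ℂ) (c : Fin 4) (x : V) : 0 ≤ jgPart f c x := le_max_right _ _

theorem jgPart_le {V : Type} (f : V → ℂ) (c : Fin 4) (x : V) : jgPart f c x ≤ ‖f x‖ := by
  apply max_le _ (norm_nonneg _)
  have h1 := Complex.abs_re_le_norm (f x)
  have h2 := Complex.abs_im_le_norm (f x)
  rw [abs_le] at h1 h2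
  fin_cases c <;> simp <;> linarith

theorem jgPart_eq {V : Type} (f : V → ℂ) (x : V) : f x = ((jgPart f 0 x - jgPart f 1 x : ℝ) : ℂ) +
    ((jgPart f 2 x - jgPart f 3 x : ℝ) : ℂ) * Complex.I := by
  have h : ∀ a : ℝ, max a 0 - max (-a) 0 = a := by
    intro a
    rcases le_total a 0 with h | h
    · rw [max_eq_right h, max_eq_left (by linarith)]; ring
    · rw [max_eq_left h, max_eq_right (by linarith)]; ring
  simp only [jgPart]
  simp only [Matrix.cons_val]
  rw [h, h, Complex.re_add_im]

theorem jgPhi_eq (d n : ℕ) (q : ℝ) (hq : 0 < q) (f : (Fin d → ℤ) → ℂ) (x : Fin d → ℤ) :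
    jgPhi d n q f x = ((jgAct _ (jgKer d n q) (jgPart f 0) x - jgAct _ (jgKer d n q) (jgPart f 1) x : ℝ) : ℂ)
     + ((jgAct _ (jgKer d n q) (jgPart f 2) x - jgAct _ (jgKer d n q) (jgPart f 3) x : ℝ) : ℂ) * Complex.I := by
  simp only [jgKer_act d n q hq]
  rw [← Finset.sum_sub_distrib, ← Finset.sum_sub_distrib]
  unfold jgPhi
  rw [Complex.ofReal_sum, Complex.ofReal_sum, Finset.sum_mul, ← Finset.sum_add_distrib]
  refine Finset.sum_congr rfl fun k _ => ?_
  conv_lhs => rw [jgPart_eq f (x-k)]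
  push_cast; ring

theorem jgPhi_diff (d n : ℕ) (q q' : ℝ) (hq : 0 < q) (hq' : 0 < q') (f : (Fin d → ℤ) → ℂ) (x : Fin d → ℤ)
    (lam : ℝ) (h : 4 * lam ≤ ‖jgPhi d n q f x - jgPhi d n q' f x‖) :
    ∃ c : Fin 4, lam ≤ |jgAct _ (jgKer d n q) (jgPart f c) x - jgAct _ (jgKer d n q') (jgPart f c) x| := by
  by_contra hcon
  push Not at hcon
  rw [jgPhi_eq d n q hq, jgPhi_eq d n q' hq'] at h
  have h0 := hcon 0
  have h1 := hcon 1
  have h2 := hcon 2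
  have h3 := hcon 3
  generalize jgAct _ (jgKer d n q) (jgPart f 0) x = a0 at *
  generalize jgAct _ (jgKer d n q) (jgPart f 1) x = a1 at *
  generalize jgAct _ (jgKer d n q) (jgPart f 2) x = a2 at *
  generalize jgAct _ (jgKer d n q) (jgPart f 3) x = a3 at *
  generalize jgAct _ (jgKer d n q') (jgPart f 0) x = b0 at *
  generalize jgAct _ (jgKer d n q') (jgPart f 1) x = b1 at *
  generalize jgAct _ (jgKer d n q') (jgPart f 2) x = b2 at *
  generalize jgAct _ (jgKer d n q') (jgPart f 3) x = b3 at *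
  have := Complex.norm_le_abs_re_add_abs_im
    (((a0 - a1 : ℝ):ℂ) + ((a2 - a3 : ℝ):ℂ) * Complex.I - (((b0 - b1 : ℝ):ℂ) + ((b2 - b3 : ℝ):ℂ) * Complex.I))
  simp only [Complex.sub_re, Complex.add_re, Complex.mul_re, Complex.ofReal_re, Complex.I_re, mul_zero,
    Complex.ofReal_im, Complex.I_im, mul_one, Complex.sub_im, Complex.add_im, Complex.mul_im,
    sub_zero, add_zero, zero_add] at this
  rw [abs_lt] at h0 h1 h2 h3
  rcases abs_cases (a0 - a1 - (b0 - b1)) with u | u <;> rcases abs_cases (a2 - a3 - (b2 - b3)) with v | v <;> linarith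

end JGKer

section JGFinal
open Filter Topology

theorem jg_enum (T : Finset ℝ) (hT : T.Nonempty) : ∃ (I : ℕ) (U : ℕ → ℝ), Monotone U ∧
    (∀ i, U i ∈ T) ∧ (∀ i j, i < j → j ≤ I → U i < U j) ∧ ∀ s ∈ T, ∃ i ≤ I, U i = s := by
  obtain ⟨I, hI⟩ : ∃ I, T.card = I + 1 := ⟨T.card - 1, by have := hT.card_pos; omega⟩
  refine ⟨I, fun i => T.orderEmbOfFin hI ⟨min i I, by omega⟩, ?_, ?_, ?_, ?_⟩
  · intro i j hij
    apply (T.orderEmbOfFin hI).monotone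
    exact Fin.mk_le_mk.2 (min_le_min_right I hij)
  · intro i; exact Finset.orderEmbOfFin_mem _ _ _
  · intro i j hij hj
    apply (T.orderEmbOfFin hI).strictMono
    rw [Fin.mk_lt_mk]; omega
  · intro s hs
    have : s ∈ Set.range (T.orderEmbOfFin hI) := by rw [Finset.range_orderEmbOfFin]; exact hs
    obtain ⟨i, hi⟩ := this
    refine ⟨i, by omega, ?_⟩
    rw [← hi]
    beta_reduce
    refine congrArg (T.orderEmbOfFin hI) (Fin.ext ?_)
    simp only
    omega

theorem jg_fin (p : ℝ) (hp : 1 < p) : ∃ C : ℝ, 0 ≤ C ∧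
    ∀ (d : ℕ) (f : (Fin d → ℤ) → ℂ) (B : ℝ) (_ : ∀ x, ‖f x‖ ≤ B) (lam : ℝ) (_ : 0 < lam)
    (X : Finset (Fin d → ℤ)) (J : (Fin d → ℤ) → ℕ) (u : ∀ x, Fin (J x + 1) → ℝ)
    (_ : ∀ x, StrictMono (u x)) (_ : ∀ x j, 0 < u x j)
    (_ : ∀ x, ∀ j : Fin (J x), lam ≤ ‖gConv d (u x j.succ) f x - gConv d (u x j.castSucc) f x‖),
    ∑ x ∈ X, ENNReal.ofReal ((J x : ℝ)^(p/2)) ≤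
      ENNReal.ofReal (C * lam ^ (-p)) * ∑' x, ENNReal.ofReal (‖f x‖ ^ p) := by
  obtain ⟨C, hC, H⟩ := jg_core p hp
  refine ⟨4 * (4:ℝ)^(p/2) * C * (1/32:ℝ)^(-p), by positivity, ?_⟩
  intro d f B hB lam hlam X J u hu hu0 hj
  classical
  rcases X.eq_empty_or_nonempty with rfl | hX
  · simp
  set T : Finset ℝ := X.biUnion (fun x => Finset.univ.image (u x)) with hT
  have hTm : ∀ x ∈ X, ∀ j, u x j ∈ T := fun x hx j =>
    Finset.mem_biUnion.2 ⟨x, hx, Finset.mem_image_of_mem _ (Finset.mem_univ _)⟩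
  have hTn : T.Nonempty := by
    obtain ⟨x, hx⟩ := hX
    exact ⟨_, hTm x hx 0⟩
  have hT0 : ∀ s ∈ T, 0 < s := by
    intro s hs
    obtain ⟨x, _, hx⟩ := Finset.mem_biUnion.1 hs
    obtain ⟨j, _, rfl⟩ := Finset.mem_image.1 hx
    exact hu0 x j
  obtain ⟨I, U, hU, hUT, hUs, hUe⟩ := jg_enum T hTn
  -- indices
  have hv : ∀ x, ∃ v : ℕ → ℕ, Monotone v ∧ (∀ i, v i ≤ I) ∧
      (x ∈ X → ∀ j : ℕ, U (v j) = u x ⟨min j (J x), by omega⟩) := by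
    intro x
    by_cases hx : x ∈ X
    · choose v hvI hvU using fun j : ℕ => hUe _ (hTm x hx ⟨min j (J x), by omega⟩)
      refine ⟨v, ?_, hvI, fun _ => hvU⟩
      intro i j hij
      by_contra hlt
      push Not at hlt
      have h1 := hUs _ _ hlt (hvI i)
      rw [hvU, hvU] at h1
      have h2 : (⟨min i (J x), by omega⟩ : Fin (J x + 1)) ≤ ⟨min j (J x), by omega⟩ :=
        Fin.mk_le_mk.2 (min_le_min_right _ hij)
      have := (hu x).monotone h2
      linarith
    · exact ⟨fun _ => 0, fun _ _ _ => le_rfl, fun _ => Nat.zero_le _, fun h => absurd h hx⟩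
  choose v hvm hvI hvU using hv
  have hUpos : ∀ i, 0 < U i := fun i => hT0 _ (hUT i)
  set q : ℕ → ℝ := fun i => Real.exp (-π / U i) with hq
  have q0 : ∀ i, 0 < q i := fun i => Real.exp_pos _
  have q1 : ∀ i, q i < 1 := by
    intro i
    simp only [hq]
    rw [Real.exp_lt_one_iff]
    exact div_neg_of_neg_of_pos (by linarith [Real.pi_pos]) (hUpos i)
  have qm : Monotone q := by
    intro i j hij
    simp only [hq]
    apply Real.exp_le_exp.2
    rw [neg_div, neg_div]
    apply neg_le_neg
    exact div_le_div_of_nonneg_left Real.pi_pos.le (hUpos i) (hU hij)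
  -- choose n
  have ev : ∀ᶠ n in atTop, ∀ x ∈ X, ∀ j ∈ Finset.range (J x),
      lam / 2 ≤ ‖jgPhi d n (q (v x (j+1))) f x - jgPhi d n (q (v x j)) f x‖ := by
    rw [eventually_all_finset]
    intro x hx
    rw [eventually_all_finset]
    intro j hjr
    rw [Finset.mem_range] at hjr
    have l1 := jgPhi_tendsto d (U (v x (j+1))) (hUpos _) f B hB x
    have l2 := jgPhi_tendsto d (U (v x j)) (hUpos _) f B hB x
    have l3 := (l1.sub l2).norm
    have h1 := hj x ⟨j, hjr⟩
    have e1 : U (v x (j+1)) = u x (Fin.succ ⟨j, hjr⟩) := by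
      rw [hvU x hx]; congr 1; apply Fin.ext; simp; omega
    have e2 : U (v x j) = u x (Fin.castSucc ⟨j, hjr⟩) := by
      rw [hvU x hx]; congr 1; apply Fin.ext; simp; omega
    rw [← e1, ← e2] at h1
    have := l3.eventually (lt_mem_nhds (show lam / 2 < _ by linarith))
    filter_upwards [this] with n hn using hn.le
  obtain ⟨n, hn⟩ := ev.exists
  set S : Fin 4 → (Fin d → ℤ) → Finset ℕ := fun c x => (Finset.range (J x)).filter fun i =>
    4 * (lam * (1/32)) ≤ |jgAct _ (jgKer d n (q (v x (i+1)))) (jgPart f c) x -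
      jgAct _ (jgKer d n (q (v x i))) (jgPart f c) x| with hS
  have key : ∀ c, ∑ x ∈ X, ENNReal.ofReal (((S c x).card : ℝ)^(p/2)) ≤
      ENNReal.ofReal (C * (lam * (1/32)) ^ (-p)) * ∑' x, ENNReal.ofReal (‖f x‖ ^ p) := by
    intro c
    refine (H _ I _ (jgKer_rep d n I q qm q0 q1) (jgPart f c) (jgPart_nonneg f c) (lam * (1/32))
      (by positivity) X (S c) v hvm hvI ?_).trans ?_
    · intro x _ i hi
      exact (Finset.mem_filter.1 hi).2
    · refine mul_le_mul_right (ENNReal.tsum_le_tsum fun x => ENNReal.ofReal_le_ofReal ?_) _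
      exact Real.rpow_le_rpow (jgPart_nonneg f c x) (jgPart_le f c x) (by linarith)
  have hα : 0 < p/2 := by linarith
  have card : ∀ x ∈ X, (J x : ℝ)^(p/2) ≤ (4:ℝ)^(p/2) * ∑ c, ((S c x).card : ℝ)^(p/2) := by
    intro x hx
    have h1 : Finset.range (J x) ⊆ Finset.univ.biUnion (fun c => S c x) := by
      intro j hjr
      obtain ⟨c, hc⟩ := jgPhi_diff d n _ _ (q0 (v x (j+1))) (q0 (v x j)) f x (lam / 8) (by
        have := hn x hx j hjr
        linarith)
      refine Finset.mem_biUnion.2 ⟨c, Finset.mem_univ _, Finset.mem_filter.2 ⟨hjr, ?_⟩⟩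
      linarith
    have h2 := (Finset.card_le_card h1).trans Finset.card_biUnion_le
    rw [Finset.card_range] at h2
    obtain ⟨c, _, hc⟩ := Finset.exists_max_image Finset.univ (fun c => (S c x).card) ⟨0, Finset.mem_univ _⟩
    have h3 : J x ≤ 4 * (S c x).card := by
      refine h2.trans ((Finset.sum_le_card_nsmul _ _ _ hc).trans ?_)
      simp
    have h4 : (J x : ℝ) ≤ 4 * ((S c x).card : ℝ) := by exact_mod_cast h3
    calc (J x : ℝ)^(p/2) ≤ (4 * ((S c x).card : ℝ))^(p/2) := Real.rpow_le_rpow (by positivity) h4 hα.le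
      _ = (4:ℝ)^(p/2) * ((S c x).card : ℝ)^(p/2) := Real.mul_rpow (by norm_num) (by positivity)
      _ ≤ _ := by
        gcongr
        exact Finset.single_le_sum (f := fun c => ((S c x).card : ℝ)^(p/2)) (fun c _ => by positivity) (Finset.mem_univ c)
  calc ∑ x ∈ X, ENNReal.ofReal ((J x : ℝ)^(p/2))
      ≤ ∑ x ∈ X, ENNReal.ofReal ((4:ℝ)^(p/2)) * ∑ c, ENNReal.ofReal (((S c x).card : ℝ)^(p/2)) := by
        refine Finset.sum_le_sum fun x hx => ?_
        rw [← ENNReal.ofReal_sum_of_nonneg (fun c _ => by positivity), ← ENNReal.ofReal_mul (by positivity)]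
        exact ENNReal.ofReal_le_ofReal (card x hx)
    _ = ENNReal.ofReal ((4:ℝ)^(p/2)) * ∑ c, ∑ x ∈ X, ENNReal.ofReal (((S c x).card : ℝ)^(p/2)) := by
        rw [← Finset.mul_sum, Finset.sum_comm]
    _ ≤ ENNReal.ofReal ((4:ℝ)^(p/2)) * ∑ _c : Fin 4, ENNReal.ofReal (C * (lam * (1/32)) ^ (-p)) * ∑' x, ENNReal.ofReal (‖f x‖ ^ p) :=
        mul_le_mul_right (Finset.sum_le_sum fun c _ => key c) _
    _ = _ := by
        rw [Finset.sum_const, Finset.card_univ, Fintype.card_fin, nsmul_eq_mul, ← mul_assoc, ← mul_assoc]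
        congr 1
        rw [← ENNReal.ofReal_natCast, ← ENNReal.ofReal_mul (by positivity), ← ENNReal.ofReal_mul (by positivity)]
        congr 1
        rw [Real.mul_rpow hlam.le (by norm_num)]
        push_cast; ring

theorem jg_sum_bound (p : ℝ) (hp : 1 < p) : ∃ C : ℝ, 0 ≤ C ∧
    ∀ (d : ℕ) (f : (Fin d → ℤ) → ℂ) (B : ℝ) (_ : ∀ x, ‖f x‖ ≤ B) (lam : ℝ) (_ : 0 < lam),
    ∑' x, (jumpCount (fun t => gConv d t f x) (Set.Ioi 0) lam)^(p/2) ≤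
      ENNReal.ofReal (C * lam ^ (-p)) * ∑' x, ENNReal.ofReal (‖f x‖ ^ p) := by
  obtain ⟨C, hC, H⟩ := jg_fin p hp
  refine ⟨C, hC, ?_⟩
  intro d f B hB lam hlam
  classical
  have hα : 0 < p/2 := by linarith
  set P : (Fin d → ℤ) → ℕ → Prop := fun x J => ∃ u : Fin (J + 1) → ℝ, StrictMono u ∧
    (∀ j, u j ∈ Set.Ioi (0:ℝ)) ∧ ∀ j : Fin J, lam ≤ ‖gConv d (u j.succ) f x - gConv d (u j.castSucc) f x‖ with hP
  have P0 : ∀ x, P x 0 := fun x => ⟨fun _ => 1, fun a b h => absurd h (by have := a.isLt; have := b.isLt; rw [Fin.lt_def]; omega), fun _ => by simp, fun j => j.elim0⟩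
  set g : ℕ → (Fin d → ℤ) → ℕ := fun m x => Nat.findGreatest (P x) m with hg
  have gP : ∀ m x, P x (g m x) := fun m x => Nat.findGreatest_spec (Nat.zero_le m) (P0 x)
  have gm : ∀ x, Monotone (fun m => g m x) := fun x m m' h => Nat.findGreatest_mono_right _ h
  have N1 : ∀ x, (jumpCount (fun t => gConv d t f x) (Set.Ioi 0) lam)^(p/2) ≤
      ⨆ m : ℕ, ENNReal.ofReal ((g m x : ℝ)^(p/2)) := by
    intro x
    have h1 : jumpCount (fun t => gConv d t f x) (Set.Ioi 0) lam ≤ ⨆ m : ℕ, (g m x : ℝ≥0∞) := by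
      unfold jumpCount
      refine iSup₂_le fun J hJ => ?_
      refine le_trans ?_ (le_iSup _ J)
      have : J ≤ g J x := Nat.le_findGreatest le_rfl hJ
      exact_mod_cast this
    refine (ENNReal.rpow_le_rpow h1 hα.le).trans (le_of_eq ?_)
    have := (ENNReal.orderIsoRpow (p/2) hα).map_iSup (fun m : ℕ => (g m x : ℝ≥0∞))
    simp only [ENNReal.orderIsoRpow_apply] at this
    rw [this]
    congr 1; funext m
    rw [← ENNReal.ofReal_rpow_of_nonneg (by positivity) hα.le, ENNReal.ofReal_natCast]
  rw [ENNReal.tsum_eq_iSup_sum]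
  refine iSup_le fun X => ?_
  refine (Finset.sum_le_sum fun x _ => N1 x).trans ?_
  rw [ENNReal.finsetSum_iSup_of_monotone]
  · refine iSup_le fun m => ?_
    choose u hu1 hu2 hu3 using fun x => gP m x
    exact H d f B hB lam hlam X (g m) u hu1 hu2 hu3
  · intro x m m' h
    apply ENNReal.ofReal_le_ofReal
    apply Real.rpow_le_rpow (by positivity) _ hα.le
    exact_mod_cast gm x h

end JGFinal

theorem jump_gauss_dimension_free (p : ℝ) (hp : 1 < p) :
    ∃ C : ℝ, 0 < C ∧ ∀ d : ℕ, 0 < d → ∀ f : (Fin d → ℤ) → ℂ,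
      lpNorm d p (fun x => (‖f x‖₊ : ℝ≥0∞)) < ⊤ →
      ∀ lam : ℝ, 0 < lam →
      lpNorm d p (fun x =>
          ENNReal.ofReal lam * (jumpCount (fun t => gConv d t f x) (Set.Ioi 0) lam) ^ (1/2 : ℝ))
        ≤ ENNReal.ofReal C * lpNorm d p (fun x => (‖f x‖₊ : ℝ≥0∞)) := by
  obtain ⟨C, hC, H⟩ := jg_sum_bound p hp
  refine ⟨(C+1)^(1/p), by positivity, ?_⟩
  intro d _ f hf lam hlam
  have p0 : 0 < p := by linarith
  have p0' : 0 < 1/p := by positivity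
  have e : ∀ x, (‖f x‖₊ : ℝ≥0∞)^p = ENNReal.ofReal (‖f x‖^p) := by
    intro x
    rw [← ENNReal.ofReal_rpow_of_nonneg (norm_nonneg _) p0.le, ofReal_norm]
    rfl
  unfold lpNorm at *
  obtain ⟨B, hB⟩ : ∃ B : ℝ, ∀ x, ‖f x‖ ≤ B := by
    refine ⟨((∑' x, (‖f x‖₊ : ℝ≥0∞)^p)^(1/p)).toReal, fun x => ?_⟩
    have h1 : (‖f x‖₊ : ℝ≥0∞)^p ≤ ∑' x, (‖f x‖₊ : ℝ≥0∞)^p := ENNReal.le_tsum x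
    have h2 := ENNReal.rpow_le_rpow h1 p0'.le
    rw [← ENNReal.rpow_mul, mul_one_div_cancel p0.ne', ENNReal.rpow_one] at h2
    have := ENNReal.toReal_mono hf.ne h2
    simpa using this
  have h := H d f B hB lam hlam
  have e2 : ∀ x, (ENNReal.ofReal lam * (jumpCount (fun t => gConv d t f x) (Set.Ioi 0) lam) ^ (1/2 : ℝ))^p
      = ENNReal.ofReal (lam^p) * (jumpCount (fun t => gConv d t f x) (Set.Ioi 0) lam) ^ (p/2) := by
    intro x
    rw [ENNReal.mul_rpow_of_nonneg _ _ p0.le, ENNReal.ofReal_rpow_of_pos hlam, ← ENNReal.rpow_mul]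
    congr 2; ring
  simp only [e2, e]
  rw [ENNReal.tsum_mul_left]
  calc _ ≤ (ENNReal.ofReal (C+1) * ∑' x, ENNReal.ofReal (‖f x‖ ^ p))^(1/p) := by
        apply ENNReal.rpow_le_rpow _ p0'.le
        calc _ ≤ ENNReal.ofReal (lam^p) * (ENNReal.ofReal (C * lam ^ (-p)) * ∑' x, ENNReal.ofReal (‖f x‖ ^ p)) :=
              mul_le_mul_right h _
          _ = ENNReal.ofReal C * ∑' x, ENNReal.ofReal (‖f x‖ ^ p) := by
              rw [← mul_assoc, ← ENNReal.ofReal_mul (by positivity)]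
              congr 2
              rw [Real.rpow_neg hlam.le]
              field_simp
          _ ≤ _ := by
              gcongr
              linarith
    _ = _ := by
        rw [ENNReal.mul_rpow_of_nonneg _ _ p0'.le, ENNReal.ofReal_rpow_of_pos (by positivity)]
end
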